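/- arXiv:2105.04775 — 8 statements merged into one kernel-verified Lean document; each statement's English description precedes it below -/
import Mathlib

section
/- A span f : [m] → [p], g : [m] → [q] in the simplex category Δ has a pushout in Δ if and only if the following three conditions hold: (1) for every i with 1 ≤ i ≤ m, f(i) ≤ f(i−1) + 1 or g(i) ≤ g(i−1) + 1; (2) f(0) = 0 or g(0) = 0; (3) f(m) = p or g(m) = q. -/
open CategoryTheory CategoryTheory.Limits SimplexCategory

section OrderSpan

variable {α β γ δ : Type*} [Preorder α] [Preorder β] [Preorder γ] [Preorder δ]

/-- The carrier `β ⊕ γ` of the pushout of a span of monotone maps `f : α →o β`, `g : α →o γ`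
in the category of preorders. -/
def OrderSpan (_ : α →o β) (_ : α →o γ) : Type _ := β ⊕ γ

namespace OrderSpan

variable {f : α →o β} {g : α →o γ}

/-- A subset of `β ⊕ γ` is a compatible upper set if its traces on `β` and `γ` are upper sets
with the same preimage in `α`. -/
structure IsCompatibleUpper (f : α →o β) (g : α →o γ) (S : Set (β ⊕ γ)) : Prop where
  inl : IsUpperSet (Sum.inl ⁻¹' S)
  inr : IsUpperSet (Sum.inr ⁻¹' S)
  glue : ∀ a, Sum.inl (f a) ∈ S ↔ Sum.inr (g a) ∈ S

/-- The pushout preorder: `x ≤ y` if every compatible upper set containing `x` contains `y`. -/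
instance : Preorder (OrderSpan f g) where
  le x y := ∀ S, IsCompatibleUpper f g S → x ∈ S → y ∈ S
  le_refl _ _ _ h := h
  le_trans _ _ _ h₁ h₂ S hS h := h₂ S hS (h₁ S hS h)

instance [Finite β] [Finite γ] : Finite (OrderSpan f g) :=
  inferInstanceAs (Finite (β ⊕ γ))

variable (f g) in
/-- The first map into the pushout. -/
def inl : β →o OrderSpan f g where
  toFun := Sum.inl
  monotone' _ _ h _ hS hx := hS.inl h hx

variable (f g) in
/-- The second map into the pushout. -/
def inr : γ →o OrderSpan f g where
  toFun := Sum.inr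
  monotone' _ _ h _ hS hx := hS.inr h hx

theorem glue (a : α) : AntisymmRel (· ≤ ·) (inl f g (f a)) (inr f g (g a)) :=
  ⟨fun _ hS h => (hS.glue a).1 h, fun _ hS h => (hS.glue a).2 h⟩

/-- The monotone map out of the pushout induced by a cocone. -/
def desc (h : β →o δ) (k : γ →o δ) (w : ∀ a, h (f a) = k (g a)) : OrderSpan f g →o δ where
  toFun := Sum.elim h k
  monotone' x y hxy :=
    hxy {z | Sum.elim h k x ≤ Sum.elim h k z}
      ⟨fun _ _ hab ha => le_trans ha (h.monotone hab),
        fun _ _ hab ha => le_trans ha (k.monotone hab),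
        fun a => by simp [w]⟩ le_rfl

@[simp]
theorem desc_inl (h : β →o δ) (k : γ →o δ) (w : ∀ a, h (f a) = k (g a)) (b : β) :
    desc h k w (inl f g b) = h b := rfl

@[simp]
theorem desc_inr (h : β →o δ) (k : γ →o δ) (w : ∀ a, h (f a) = k (g a)) (c : γ) :
    desc h k w (inr f g c) = k c := rfl

theorem total_of_inl_inr {β γ : Type*} [LinearOrder β] [LinearOrder γ]
    {f : α →o β} {g : α →o γ}
    (h : ∀ b c, inl f g b ≤ inr f g c ∨ inr f g c ≤ inl f g b) (x y : OrderSpan f g) :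
    x ≤ y ∨ y ≤ x := by
  rcases x with b | c <;> rcases y with b' | c'
  · exact (le_total b b').imp (fun h => (inl f g).monotone h) (fun h => (inl f g).monotone h)
  · exact h b c'
  · exact (h b' c).symm
  · exact (le_total c c').imp (fun h => (inr f g).monotone h) (fun h => (inr f g).monotone h)

theorem inl_le_inr_or_inr_le_inl {m p q : ℕ} {f : Fin (m + 1) →o Fin (p + 1)}
    {g : Fin (m + 1) →o Fin (q + 1)}
    (hstep : ∀ i : Fin m, (f i.succ : ℕ) ≤ f i.castSucc + 1 ∨ (g i.succ : ℕ) ≤ g i.castSucc + 1)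
    (hzero : f 0 = 0 ∨ g 0 = 0) (hlast : f (Fin.last m) = Fin.last p ∨ g (Fin.last m) = Fin.last q)
    (b : Fin (p + 1)) (c : Fin (q + 1)) :
    inl f g b ≤ inr f g c ∨ inr f g c ≤ inl f g b := by
  have key (i : Fin (m + 1)) (hi : b ≤ f i ∨ c ≤ g i) (hi' : f i ≤ b ∨ g i ≤ c) :
      inl f g b ≤ inr f g c ∨ inr f g c ≤ inl f g b := by
    have left (h₁ : b ≤ f i) (h₂ : g i ≤ c) : inl f g b ≤ inr f g c :=
      ((inl f g).monotone h₁).trans ((glue i).1.trans ((inr f g).monotone h₂))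
    have right (h₁ : c ≤ g i) (h₂ : f i ≤ b) : inr f g c ≤ inl f g b :=
      ((inr f g).monotone h₁).trans ((glue i).2.trans ((inl f g).monotone h₂))
    grind
  have below (i : Fin (m + 1)) :
      (inl f g b ≤ inr f g c ∨ inr f g c ≤ inl f g b) ∨ (f i < b ∧ g i < c) := by
    induction i using Fin.induction with
    | zero =>
      have := Fin.zero_le b
      have := Fin.zero_le c
      grind
    | succ i ih =>
      refine ih.elim Or.inl fun hlt => ?_
      have := hstep i
      have := key i.succ
      grind
  have := below (Fin.last m)
  have := Fin.le_last b
  have := Fin.le_last c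
  grind

end OrderSpan

end OrderSpan

namespace SimplexCategory

/-- If the pushout of preorders of a span in the simplex category is totally preordered, then its
quotient by antisymmetry is a pushout in the simplex category. -/
theorem hasPushout_of_total {x y z : SimplexCategory} (f : x ⟶ y) (g : x ⟶ z)
    (htotal : ∀ a b : OrderSpan f.toOrderHom g.toOrderHom, a ≤ b ∨ b ≤ a) : HasPushout f g := by
  classical
  let P := OrderSpan f.toOrderHom g.toOrderHom
  let ι₁ : _ →o P := OrderSpan.inl f.toOrderHom g.toOrderHom
  let ι₂ : _ →o P := OrderSpan.inr f.toOrderHom g.toOrderHom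
  let Q := Antisymmetrization P (· ≤ ·)
  have : Std.Total (α := P) (· ≤ ·) := ⟨htotal⟩
  have : Finite Q := Quotient.finite _
  have : Nonempty Q := ⟨toAntisymmetrization _ (ι₁ 0)⟩
  let _ : Fintype Q := Fintype.ofFinite Q
  obtain ⟨n, hn⟩ := Nat.exists_eq_succ_of_ne_zero (Fintype.card_ne_zero (α := Q))
  let e : Fin (n + 1) ≃o Q := Fintype.orderIsoFinOfCardEq Q hn
  let π : P →o Fin (n + 1) :=
    ⟨fun a => e.symm (toAntisymmetrization _ a), fun _ _ h => e.symm.monotone h⟩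
  have hπ {a b : P} (h : AntisymmRel (· ≤ ·) a b) : π a = π b :=
    congrArg e.symm (Quotient.sound h)
  let j₁ : y ⟶ mk n := Hom.mk (π.comp ι₁)
  let j₂ : z ⟶ mk n := Hom.mk (π.comp ι₂)
  have w : f ≫ j₁ = g ≫ j₂ := by
    ext a : 3
    exact hπ (OrderSpan.glue a)
  have huniv (s : PushoutCocone f g) : ∃ d : mk n ⟶ s.pt, ∀ a,
      d.toOrderHom (π a) = Sum.elim s.inl.toOrderHom s.inr.toOrderHom a := by
    let D : P →o Fin (s.pt.len + 1) := OrderSpan.desc s.inl.toOrderHom s.inr.toOrderHom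
      fun a => DFunLike.congr_fun (congrArg Hom.toOrderHom s.condition) a
    refine ⟨Hom.mk ⟨fun i => D (ofAntisymmetrization _ (e i)), fun _ _ h => D.monotone ?_⟩,
      fun a => ?_⟩
    · exact ofAntisymmetrization_le_ofAntisymmetrization_iff.2 (e.monotone h)
    · have hrel : AntisymmRel (· ≤ ·) (ofAntisymmetrization (· ≤ ·) (e (π a))) a := by
        refine Quotient.exact (s := AntisymmRel.setoid P (· ≤ ·)) ?_
        exact (toAntisymmetrization_ofAntisymmetrization _ _).trans (e.apply_symm_apply _)
      exact le_antisymm (D.monotone hrel.1) (D.monotone hrel.2)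
  have hsurj (i : Fin (n + 1)) : ∃ a, π a = i :=
    ⟨ofAntisymmetrization _ (e i), (congrArg e.symm
      (toAntisymmetrization_ofAntisymmetrization _ _)).trans (e.symm_apply_apply _)⟩
  choose d hd using huniv
  refine ⟨⟨PushoutCocone.mk j₁ j₂ w, PushoutCocone.IsColimit.mk w d ?_ ?_ ?_⟩⟩
  · intro s
    ext a : 3
    exact hd s (Sum.inl a)
  · intro s
    ext a : 3
    exact hd s (Sum.inr a)
  · intro s d' h₁ h₂
    ext i : 3
    obtain ⟨a, rfl⟩ := hsurj i
    refine Eq.trans ?_ (hd s a).symm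
    rcases a with a | a
    · exact DFunLike.congr_fun (congrArg Hom.toOrderHom h₁) a
    · exact DFunLike.congr_fun (congrArg Hom.toOrderHom h₂) a

/-- The morphism to `⦋1⦌` taking the value `1` exactly on the elements that are at least `a`. -/
def threshold (x : SimplexCategory) (a : ℕ) : x ⟶ mk 1 :=
  Hom.mk
    { toFun := fun i => if a ≤ (i : ℕ) then (1 : Fin 2) else 0
      monotone' := fun i j h => by
        have : (i : ℕ) ≤ j := h
        dsimp only
        split_ifs <;> first | omega | simp }

theorem threshold_apply (x : SimplexCategory) (a : ℕ) (i : Fin (x.len + 1)) :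
    (threshold x a).toOrderHom i = if a ≤ (i : ℕ) then (1 : Fin 2) else 0 := rfl

theorem comp_threshold_eq {x y z : SimplexCategory} {f : x ⟶ y} {g : x ⟶ z} {a b : ℕ}
    (h : ∀ i, a ≤ (f.toOrderHom i : ℕ) ↔ b ≤ (g.toOrderHom i : ℕ)) :
    f ≫ threshold y a = g ≫ threshold z b := by
  ext i : 3
  exact if_congr (h i) rfl rfl

theorem le_or_le_of_hom_mk_one {n : SimplexCategory} (d d' : n ⟶ mk 1) :
    d.toOrderHom ≤ d'.toOrderHom ∨ d'.toOrderHom ≤ d.toOrderHom := by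
  by_contra! h
  simp only [OrderHom.le_def, not_forall, not_le] at h
  obtain ⟨⟨i, hi⟩, j, hj⟩ := h
  have := (d.toOrderHom i).isLt
  have := (d.toOrderHom j).isLt
  have := (d'.toOrderHom i).isLt
  have := (d'.toOrderHom j).isLt
  rcases le_total i j with hij | hij
  all_goals
    have h₁ := d.toOrderHom.monotone hij
    have h₂ := d'.toOrderHom.monotone hij
    simp only [len_mk, Fin.lt_def, Fin.le_def] at *
    omega

/-- A pair of elements `a`, `b` that can be separated in both directions by morphisms to `⦋1⦌`
obstructs the existence of a pushout. -/
theorem not_hasPushout_of_thresholds {x y z : SimplexCategory} {f : x ⟶ y} {g : x ⟶ z} {a b : ℕ}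
    (ha : a ≤ y.len) (hb : b ≤ z.len)
    (h₁ : ∀ i, a + 1 ≤ (f.toOrderHom i : ℕ) ↔ b ≤ (g.toOrderHom i : ℕ))
    (h₂ : ∀ i, a ≤ (f.toOrderHom i : ℕ) ↔ b + 1 ≤ (g.toOrderHom i : ℕ)) :
    ¬ HasPushout f g := by
  intro _
  have w₁ := comp_threshold_eq h₁
  have w₂ := comp_threshold_eq h₂
  have eval_inl (c e : ℕ) (w : f ≫ threshold y c = g ≫ threshold z e) (i : Fin (y.len + 1)) :
      (pushout.desc _ _ w).toOrderHom ((pushout.inl f g).toOrderHom i) =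
        (threshold y c).toOrderHom i :=
    DFunLike.congr_fun (congrArg Hom.toOrderHom (pushout.inl_desc _ _ w)) i
  have eval_inr (c e : ℕ) (w : f ≫ threshold y c = g ≫ threshold z e) (i : Fin (z.len + 1)) :
      (pushout.desc _ _ w).toOrderHom ((pushout.inr f g).toOrderHom i) =
        (threshold z e).toOrderHom i :=
    DFunLike.congr_fun (congrArg Hom.toOrderHom (pushout.inr_desc _ _ w)) i
  rcases le_or_le_of_hom_mk_one (pushout.desc _ _ w₁) (pushout.desc _ _ w₂) with h | h
  · have := h ((pushout.inr f g).toOrderHom ⟨b, by omega⟩)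
    rw [eval_inr, eval_inr, threshold_apply, threshold_apply] at this
    simp at this
  · have := h ((pushout.inl f g).toOrderHom ⟨a, by omega⟩)
    rw [eval_inl, eval_inl, threshold_apply, threshold_apply] at this
    simp at this

end SimplexCategory

/-- A span `f : [m] → [p]`, `g : [m] → [q]` in the simplex category `Δ` has a
pushout in `Δ` if and only if: (1) for every `1 ≤ i ≤ m`, `f(i) ≤ f(i-1) + 1` or
`g(i) ≤ g(i-1) + 1`; (2) `f(0) = 0` or `g(0) = 0`; (3) `f(m) = p` or `g(m) = q`. -/
theorem hasPushout_iff {m p q : ℕ}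
    (f : SimplexCategory.mk m ⟶ SimplexCategory.mk p)
    (g : SimplexCategory.mk m ⟶ SimplexCategory.mk q) :
    HasPushout f g ↔
      ((∀ i : ℕ, (h1 : 1 ≤ i) → (h2 : i ≤ m) →
          ((f.toOrderHom ⟨i, by simp only [SimplexCategory.len_mk]; omega⟩ : Fin (p + 1)) : ℕ) ≤
              (f.toOrderHom ⟨i - 1, by simp only [SimplexCategory.len_mk]; omega⟩ :
                Fin (p + 1)) + 1 ∨
            ((g.toOrderHom ⟨i, by simp only [SimplexCategory.len_mk]; omega⟩ :
                Fin (q + 1)) : ℕ) ≤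
              (g.toOrderHom ⟨i - 1, by simp only [SimplexCategory.len_mk]; omega⟩ :
                Fin (q + 1)) + 1) ∧
        (f.toOrderHom 0 = 0 ∨ g.toOrderHom 0 = 0) ∧
        (f.toOrderHom (Fin.last m) = Fin.last p ∨ g.toOrderHom (Fin.last m) = Fin.last q)) := by
  constructor
  · intro hpush
    refine ⟨fun i h1 h2 => ?_, ?_, ?_⟩
    · by_contra! h
      have hi (j : Fin (m + 1)) : (j : ℕ) ≤ i - 1 ∨ i ≤ (j : ℕ) := by omega
      refine not_hasPushout_of_thresholds (f := f) (g := g)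
        (a := f.toOrderHom ⟨i - 1, by simp only; omega⟩ + 1)
        (b := g.toOrderHom ⟨i - 1, by simp only; omega⟩ + 1) ?_ ?_ ?_ ?_ hpush
      · have := (f.toOrderHom ⟨i, by simp only; omega⟩).isLt
        omega
      · have := (g.toOrderHom ⟨i, by simp only; omega⟩).isLt
        omega
      all_goals
        intro j
        rcases hi j with hj | hj
        · have hf := f.toOrderHom.monotone (a := j) (b := ⟨i - 1, by simp only; omega⟩) hj
          have hg := g.toOrderHom.monotone (a := j) (b := ⟨i - 1, by simp only; omega⟩) hj
          rw [Fin.le_def] at hf hg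
          omega
        · have hf := f.toOrderHom.monotone (a := ⟨i, by simp only; omega⟩) (b := j) hj
          have hg := g.toOrderHom.monotone (a := ⟨i, by simp only; omega⟩) (b := j) hj
          rw [Fin.le_def] at hf hg
          omega
    · by_contra! h
      have hf0 := Fin.pos_iff_ne_zero.2 h.1
      have hg0 := Fin.pos_iff_ne_zero.2 h.2
      refine not_hasPushout_of_thresholds (f := f) (g := g) (a := 0) (b := 0)
        (Nat.zero_le _) (Nat.zero_le _) (fun j => ?_) (fun j => ?_) hpush
      · have := Fin.lt_def.1 (hf0.trans_le (f.toOrderHom.monotone (Fin.zero_le j)))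
        simp only [len_mk, Fin.val_zero] at this
        omega
      · have := Fin.lt_def.1 (hg0.trans_le (g.toOrderHom.monotone (Fin.zero_le j)))
        simp only [len_mk, Fin.val_zero] at this
        omega
    · by_contra! h
      have hfm := Fin.lt_last_iff_ne_last.2 h.1
      have hgm := Fin.lt_last_iff_ne_last.2 h.2
      refine not_hasPushout_of_thresholds (f := f) (g := g) (a := p) (b := q)
        le_rfl le_rfl (fun j => ?_) (fun j => ?_) hpush
      all_goals
        have hf := Fin.lt_def.1 ((f.toOrderHom.monotone (Fin.le_last j)).trans_lt hfm)
        have hg := Fin.lt_def.1 ((g.toOrderHom.monotone (Fin.le_last j)).trans_lt hgm)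
        simp only [len_mk, Fin.val_last] at hf hg
        omega
  · rintro ⟨hstep, hzero, hlast⟩
    exact hasPushout_of_total f g (OrderSpan.total_of_inl_inr
      (OrderSpan.inl_le_inr_or_inr_le_inl
        (fun i => hstep (i + 1) (Nat.le_add_left 1 i) i.isLt) hzero hlast))
end

section
/- Let f : [m] → [p], g : [m] → [q], h : [p] → [n], k : [q] → [n] form a pushout square in Δ (h∘f = k∘g and the square is a pushout of the span (f, g)), and let f = f₁∘f₀ with f₀ : [m] → [ℓ], f₁ : [ℓ] → [p] be an efficient factorization, i.e. δ_f = δ_{f₀} + δ_{f₁}. Then there exist an object [ℓ'] and morphisms g' : [ℓ] → [ℓ'], k₀ : [q] → [ℓ'], k₁ : [ℓ'] → [n] in Δ such that g'∘f₀ = k₀∘g, h∘f₁ = k₁∘g', k₁∘k₀ = k, and both squares (f₀, g, g', k₀) and (f₁, g', h, k₁) are pushout squares in Δ. -/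
open CategoryTheory CategoryTheory.Limits SimplexCategory

/-- The defect of a morphism in `Δ`. -/
def defect {x y : SimplexCategory} (f : x ⟶ y) : ℕ :=
  (x.len + 1) + (y.len + 1) - 2 * (Finset.image f.toOrderHom Finset.univ).card

namespace SimplexCategory

/-- An up-set of the span of `f` and `g`: an up-set of each of the two targets such that both
have the same preimage in the common source. -/
structure IsSpanUpperSet {x y z : SimplexCategory} (f : x ⟶ y) (g : x ⟶ z)
    (U : Finset (Fin (y.len + 1) ⊕ Fin (z.len + 1))) : Prop where
  inl_mem : ∀ ⦃a b⦄, a ≤ b → Sum.inl a ∈ U → Sum.inl b ∈ U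
  inr_mem : ∀ ⦃a b⦄, a ≤ b → Sum.inr a ∈ U → Sum.inr b ∈ U
  glue : ∀ c, Sum.inl (f.toOrderHom c) ∈ U ↔ Sum.inr (g.toOrderHom c) ∈ U

/-- The up-set of points that a cocone sends to values at least `r`. -/
lemma isSpanUpperSet_filter_le {x y z w : SimplexCategory} {f : x ⟶ y} {g : x ⟶ z}
    {s : y ⟶ w} {t : z ⟶ w} (hst : f ≫ s = g ≫ t) (r : Fin (w.len + 1)) :
    IsSpanUpperSet f g {a | r ≤ Sum.elim s.toOrderHom t.toOrderHom a} where
  inl_mem a b hab ha := by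
    simp only [Finset.mem_filter_univ, Sum.elim_inl] at ha ⊢
    exact ha.trans (s.toOrderHom.monotone hab)
  inr_mem a b hab ha := by
    simp only [Finset.mem_filter_univ, Sum.elim_inr] at ha ⊢
    exact ha.trans (t.toOrderHom.monotone hab)
  glue c := by
    have := congr_toOrderHom_apply hst c
    simp only [Finset.mem_filter_univ, Sum.elim_inl, Sum.elim_inr]
    exact iff_of_eq (congrArg (r ≤ ·) this)

/-- If any two points of the span are comparable for the preorder induced by its up-sets,
then the span has a pushout in `Δ`. -/
lemma exists_isPushout_of_isSpanUpperSet_total {x y z : SimplexCategory} (f : x ⟶ y) (g : x ⟶ z)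
    (htot : ∀ U V, IsSpanUpperSet f g U → IsSpanUpperSet f g V →
      ∀ a b, a ∈ U → b ∉ U → b ∈ V → a ∈ V) :
    ∃ (n : ℕ) (i : y ⟶ SimplexCategory.mk n) (j : z ⟶ SimplexCategory.mk n),
      IsPushout f g i j := by
  classical
  let rank (a : Fin (y.len + 1) ⊕ Fin (z.len + 1)) : ℕ :=
    (Finset.univ.filter fun U => IsSpanUpperSet f g U ∧ a ∈ U).card
  have rank_mono {a b} (hab : ∀ U, IsSpanUpperSet f g U → a ∈ U → b ∈ U) : rank a ≤ rank b :=
    Finset.card_le_card fun U hU => by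
      simp only [Finset.mem_filter_univ] at hU ⊢
      exact ⟨hU.1, hab U hU.1 hU.2⟩
  have mem_of_rank_le {a b} (hab : rank a ≤ rank b) (U) (hU : IsSpanUpperSet f g U)
      (ha : a ∈ U) : b ∈ U := by
    by_contra hb
    refine hab.not_gt (Finset.card_lt_card (Finset.ssubset_iff_of_subset ?_ |>.2 ⟨U, ?_, ?_⟩))
    · intro V hV
      simp only [Finset.mem_filter_univ] at hV ⊢
      exact ⟨hV.1, htot U V hU hV.1 a b ha hb hV.2⟩
    · simp [hU, ha]
    · simp [hb]
  let S : Finset ℕ := Finset.univ.image rank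
  obtain ⟨n, hn⟩ : ∃ n, S.card = n + 1 :=
    Nat.exists_eq_succ_of_ne_zero
      (Finset.card_ne_zero_of_mem (Finset.mem_image_of_mem rank (Finset.mem_univ (Sum.inl 0))))
  let e : Fin (n + 1) ≃o S := S.orderIsoOfFin hn
  let π (a : Fin (y.len + 1) ⊕ Fin (z.len + 1)) : Fin (n + 1) :=
    e.symm ⟨rank a, Finset.mem_image_of_mem rank (Finset.mem_univ a)⟩
  have π_le {a b} : π a ≤ π b ↔ rank a ≤ rank b := by simp [π]
  have π_surj (c : Fin (n + 1)) : ∃ a, π a = c := by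
    obtain ⟨a, -, ha⟩ := Finset.mem_image.1 (e c).2
    exact ⟨a, e.symm_apply_eq.2 (Subtype.ext ha)⟩
  choose σ hσ using π_surj
  let i : y ⟶ SimplexCategory.mk n := Hom.mk
    ⟨fun a => π (Sum.inl a), fun a b hab => π_le.2 (rank_mono fun U hU => hU.inl_mem hab)⟩
  let j : z ⟶ SimplexCategory.mk n := Hom.mk
    ⟨fun a => π (Sum.inr a), fun a b hab => π_le.2 (rank_mono fun U hU => hU.inr_mem hab)⟩
  have hij : f ≫ i = g ≫ j := by
    ext1
    ext1
    funext c
    exact le_antisymm (π_le.2 (rank_mono fun U hU => (hU.glue c).1))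
      (π_le.2 (rank_mono fun U hU => (hU.glue c).2))
  have key {w : SimplexCategory} {s : y ⟶ w} {t : z ⟶ w} (hst : f ≫ s = g ≫ t) {a b}
      (hab : π a ≤ π b) :
      Sum.elim s.toOrderHom t.toOrderHom a ≤ Sum.elim s.toOrderHom t.toOrderHom b := by
    simpa using mem_of_rank_le (π_le.1 hab) _ (isSpanUpperSet_filter_le hst _)
      (by simp)
  refine ⟨n, i, j, ⟨hij⟩, ⟨PushoutCocone.IsColimit.mk _
    (fun s => Hom.mk ⟨fun c => Sum.elim s.inl.toOrderHom s.inr.toOrderHom (σ c), fun c d hcd =>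
      key s.condition (by rwa [hσ, hσ])⟩) (fun s => ?_) (fun s => ?_) (fun s u hi hj => ?_)⟩⟩
  · ext1
    ext1
    funext a
    exact le_antisymm (key s.condition (b := Sum.inl a) (hσ _).le)
      (key s.condition (a := Sum.inl a) (hσ _).ge)
  · ext1
    ext1
    funext a
    exact le_antisymm (key s.condition (b := Sum.inr a) (hσ _).le)
      (key s.condition (a := Sum.inr a) (hσ _).ge)
  · ext1
    ext1
    funext c
    change u.toOrderHom c = Sum.elim s.inl.toOrderHom s.inr.toOrderHom (σ c)
    conv_lhs => rw [← hσ c]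
    rcases σ c with a | a
    · exact congr_toOrderHom_apply hi a
    · exact congr_toOrderHom_apply hj a

/-- The map to `[1]` classifying an up-set. -/
noncomputable def homOfUpperSet {x : SimplexCategory} (P : Fin (x.len + 1) → Prop)
    (hP : ∀ ⦃a b⦄, a ≤ b → P a → P b) : x ⟶ SimplexCategory.mk 1 :=
  open Classical in
  Hom.mk ⟨fun a => if P a then (1 : Fin 2) else 0, fun a b hab => by
    by_cases ha : P a
    · simp [ha, hP hab ha]
    · simp [ha]⟩

lemma homOfUpperSet_le {x y : SimplexCategory} {P : Fin (x.len + 1) → Prop}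
    {hP : ∀ ⦃a b⦄, a ≤ b → P a → P b} {Q : Fin (y.len + 1) → Prop}
    {hQ : ∀ ⦃a b⦄, a ≤ b → Q a → Q b} {a : Fin (x.len + 1)} {b : Fin (y.len + 1)}
    (hab : (homOfUpperSet P hP).toOrderHom a ≤ (homOfUpperSet Q hQ).toOrderHom b) (ha : P a) :
    Q b := by
  classical
  by_contra hb
  change (if P a then (1 : Fin 2) else 0) ≤ (if Q b then (1 : Fin 2) else 0) at hab
  simp [ha, hb] at hab

/-- Two up-sets of a span with a pushout in `Δ` cannot separate a pair of points in opposite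
directions. -/
lemma _root_.CategoryTheory.IsPushout.or_of_upperSets {x y z w : SimplexCategory}
    {f : x ⟶ y} {g : x ⟶ z} {h : y ⟶ w} {k : z ⟶ w} (hpo : IsPushout f g h k)
    {P P' : Fin (y.len + 1) → Prop} {Q Q' : Fin (z.len + 1) → Prop}
    (hP : ∀ ⦃a b⦄, a ≤ b → P a → P b) (hQ : ∀ ⦃a b⦄, a ≤ b → Q a → Q b)
    (hP' : ∀ ⦃a b⦄, a ≤ b → P' a → P' b) (hQ' : ∀ ⦃a b⦄, a ≤ b → Q' a → Q' b)
    (hPQ : ∀ c, P (f.toOrderHom c) ↔ Q (g.toOrderHom c))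
    (hPQ' : ∀ c, P' (f.toOrderHom c) ↔ Q' (g.toOrderHom c))
    {a : Fin (y.len + 1)} {b : Fin (z.len + 1)} (ha : P a) (hb : Q' b) : Q b ∨ P' a := by
  have glue {R : Fin (y.len + 1) → Prop} {T : Fin (z.len + 1) → Prop}
      (hR : ∀ ⦃a b⦄, a ≤ b → R a → R b) (hT : ∀ ⦃a b⦄, a ≤ b → T a → T b)
      (hRT : ∀ c, R (f.toOrderHom c) ↔ T (g.toOrderHom c)) :
      ∃ d, h ≫ d = homOfUpperSet R hR ∧ k ≫ d = homOfUpperSet T hT := by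
    classical
    refine hpo.exists_desc _ _ ?_
    ext1
    ext1
    funext c
    change (if R _ then (1 : Fin 2) else 0) = if T _ then (1 : Fin 2) else 0
    exact if_congr (hRT c) rfl rfl
  rcases le_total (h.toOrderHom a) (k.toOrderHom b) with hab | hab
  · obtain ⟨d, hd_inl, hd_inr⟩ := glue hP hQ hPQ
    have := d.toOrderHom.monotone hab
    refine .inl (homOfUpperSet_le (hP := hP) (hQ := hQ) ?_ ha)
    rwa [← hd_inl, ← hd_inr]
  · obtain ⟨d, hd_inl, hd_inr⟩ := glue hP' hQ' hPQ'
    have := d.toOrderHom.monotone hab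
    refine .inr (homOfUpperSet_le (hP := hQ') (hQ := hP') ?_ hb)
    rwa [← hd_inl, ← hd_inr]

/-- In an efficient factorization, the second map separates the image of the first one
from its complement. -/
lemma mem_range_of_defect_comp_eq {x y z : SimplexCategory} {f₀ : x ⟶ y} {f₁ : y ⟶ z}
    (heff : defect (f₀ ≫ f₁) = defect f₀ + defect f₁) {a : Fin (y.len + 1)}
    {c : Fin (x.len + 1)} (hc : f₁.toOrderHom (f₀.toOrderHom c) = f₁.toOrderHom a) :
    a ∈ Set.range f₀.toOrderHom := by
  classical
  by_contra ha
  set I : Finset (Fin (y.len + 1)) := Finset.univ.image f₀.toOrderHom with hI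
  have ha : a ∉ I := by simpa [hI] using ha
  have hcomp : Finset.univ.image (f₀ ≫ f₁).toOrderHom = I.image f₁.toOrderHom := by
    rw [hI, Finset.image_image]
    rfl
  have hsub : Finset.univ.image f₁.toOrderHom ⊆
      I.image f₁.toOrderHom ∪ ((insert a I)ᶜ).image f₁.toOrderHom := by
    intro b hb
    obtain ⟨d, -, rfl⟩ := Finset.mem_image.1 hb
    by_cases hd : d ∈ insert a I
    · refine Finset.mem_union_left _ ?_
      rcases Finset.mem_insert.1 hd with rfl | hd
      · exact hc ▸ Finset.mem_image_of_mem _ (Finset.mem_image_of_mem _ (Finset.mem_univ c))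
      · exact Finset.mem_image_of_mem _ hd
    · exact Finset.mem_union_right _
        (Finset.mem_image_of_mem _ (Finset.mem_compl.2 hd))
  have hcard := (Finset.card_le_card hsub).trans (Finset.card_union_le _ _)
  have hcompl := Finset.card_image_le (s := (insert a I)ᶜ) (f := f₁.toOrderHom)
  have hadd := Finset.card_add_card_compl (insert a I)
  rw [Finset.card_insert_of_notMem ha, Fintype.card_fin] at hadd
  have hI_le : I.card ≤ x.len + 1 := by
    simpa using Finset.card_image_le (s := Finset.univ) (f := f₀.toOrderHom)
  have him_le : (Finset.univ.image f₁.toOrderHom).card ≤ y.len + 1 := by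
    simpa using Finset.card_image_le (s := Finset.univ) (f := f₁.toOrderHom)
  have him_le' : (Finset.univ.image f₁.toOrderHom).card ≤ z.len + 1 := by
    simpa using Finset.card_le_univ (Finset.univ.image f₁.toOrderHom)
  have hle := Finset.card_image_le (s := I) (f := f₁.toOrderHom)
  have hle' : (I.image f₁.toOrderHom).card ≤ (Finset.univ.image f₁.toOrderHom).card :=
    Finset.card_le_card (Finset.image_subset_image (Finset.subset_univ I))
  simp only [defect] at heff
  rw [hcomp, ← hI] at heff
  omega

/-- If `f₀ ≫ f₁` is efficient and has a pushout along `g` in `Δ`, then `f₀` has one, too. -/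
lemma exists_isPushout_of_defect_comp_eq {x y z t w : SimplexCategory} {f₀ : x ⟶ y} {f₁ : y ⟶ z}
    {g : x ⟶ t} {h : z ⟶ w} {k : t ⟶ w} (hpo : IsPushout (f₀ ≫ f₁) g h k)
    (heff : defect (f₀ ≫ f₁) = defect f₀ + defect f₁) :
    ∃ (n : ℕ) (i : y ⟶ SimplexCategory.mk n) (j : t ⟶ SimplexCategory.mk n),
      IsPushout f₀ g i j := by
  have comparable {U V} (hU : IsSpanUpperSet f₀ g U) (hV : IsSpanUpperSet f₀ g V) {a b}
      (haU : Sum.inl a ∈ U) (hbU : Sum.inr b ∉ U) (hbV : Sum.inr b ∈ V)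
      (haV : Sum.inl a ∉ V) : False := by
    have hUV {c} (hc : Sum.inr c ∈ U) : Sum.inr c ∈ V :=
      (le_total b c).elim (fun hbc => hV.inr_mem hbc hbV)
        (fun hcb => (hbU (hU.inr_mem hcb hc)).elim)
    by_cases ha : a ∈ Set.range f₀.toOrderHom
    · obtain ⟨c, rfl⟩ := ha
      exact haV ((hV.glue c).2 (hUV ((hU.glue c).1 haU)))
    have hne (c) : f₁.toOrderHom (f₀.toOrderHom c) ≠ f₁.toOrderHom a :=
      fun hc => ha (mem_range_of_defect_comp_eq heff hc)
    have mem_of_le {c} (hac : a ≤ f₀.toOrderHom c) :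
        Sum.inr (g.toOrderHom c) ∈ U ∧ Sum.inr (g.toOrderHom c) ∈ V :=
      have := (hU.glue c).1 (hU.inl_mem hac haU)
      ⟨this, hUV this⟩
    have notMem_of_le {c} (hca : f₀.toOrderHom c ≤ a) :
        Sum.inr (g.toOrderHom c) ∉ U ∧ Sum.inr (g.toOrderHom c) ∉ V :=
      have : Sum.inr (g.toOrderHom c) ∉ V :=
        fun hc => haV (hV.inl_mem hca ((hV.glue c).2 hc))
      ⟨fun hc => this (hUV hc), this⟩
    have := hpo.or_of_upperSets
      (P := fun d => f₁.toOrderHom a ≤ d) (P' := fun d => f₁.toOrderHom a < d)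
      (Q := fun c => Sum.inr c ∈ U) (Q' := fun c => Sum.inr c ∈ V)
      (fun _ _ hcd hc => hc.trans hcd) hU.inr_mem
      (fun _ _ hcd hc => hc.trans_le hcd) hV.inr_mem
      (fun c => by
        change f₁.toOrderHom a ≤ f₁.toOrderHom (f₀.toOrderHom c) ↔ _
        rcases le_total a (f₀.toOrderHom c) with hc | hc
        · exact iff_of_true (f₁.toOrderHom.monotone hc) (mem_of_le hc).1
        · exact iff_of_false ((f₁.toOrderHom.monotone hc).lt_of_ne (hne c)).not_ge
            (notMem_of_le hc).1)
      (fun c => by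
        change f₁.toOrderHom a < f₁.toOrderHom (f₀.toOrderHom c) ↔ _
        rcases le_total a (f₀.toOrderHom c) with hc | hc
        · exact iff_of_true ((f₁.toOrderHom.monotone hc).lt_of_ne (hne c).symm) (mem_of_le hc).2
        · exact iff_of_false (f₁.toOrderHom.monotone hc).not_gt (notMem_of_le hc).2)
      (le_refl (f₁.toOrderHom a)) hbV
    exact this.elim hbU (lt_irrefl _)
  refine exists_isPushout_of_isSpanUpperSet_total f₀ g fun U V hU hV a b haU hbU hbV => ?_
  rcases a with a | a <;> rcases b with b | b
  · exact hV.inl_mem (le_of_not_ge fun hab => hbU (hU.inl_mem hab haU)) hbV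
  · by_contra haV
    exact comparable hU hV haU hbU hbV haV
  · by_contra haV
    exact comparable hV hU hbV haV haU hbU
  · exact hV.inr_mem (le_of_not_ge fun hab => hbU (hU.inr_mem hab haU)) hbV

end SimplexCategory

/-- An efficient factorization of the top map of a pushout square in `Δ`
extends to a horizontal factorization of the square into two pushout squares. -/
theorem pushout_factorization {m p q n l : ℕ}
    (f : SimplexCategory.mk m ⟶ SimplexCategory.mk p)
    (g : SimplexCategory.mk m ⟶ SimplexCategory.mk q)
    (h : SimplexCategory.mk p ⟶ SimplexCategory.mk n)
    (k : SimplexCategory.mk q ⟶ SimplexCategory.mk n)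
    (hpo : IsPushout f g h k)
    (f₀ : SimplexCategory.mk m ⟶ SimplexCategory.mk l)
    (f₁ : SimplexCategory.mk l ⟶ SimplexCategory.mk p)
    (hfac : f₀ ≫ f₁ = f)
    (heff : defect f = defect f₀ + defect f₁) :
    ∃ (l' : ℕ) (g' : SimplexCategory.mk l ⟶ SimplexCategory.mk l')
      (k₀ : SimplexCategory.mk q ⟶ SimplexCategory.mk l')
      (k₁ : SimplexCategory.mk l' ⟶ SimplexCategory.mk n),
      f₀ ≫ g' = g ≫ k₀ ∧ f₁ ≫ h = g' ≫ k₁ ∧ k₀ ≫ k₁ = k ∧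
      IsPushout f₀ g g' k₀ ∧ IsPushout f₁ g' h k₁ := by
  subst hfac
  obtain ⟨l', g', k₀, hleft⟩ := SimplexCategory.exists_isPushout_of_defect_comp_eq hpo heff
  have hw : f₀ ≫ f₁ ≫ h = g ≫ k := by rw [← Category.assoc, hpo.w]
  exact ⟨l', g', k₀, hleft.desc (f₁ ≫ h) k hw, hleft.w, (hleft.inl_desc _ _ _).symm,
    hleft.inr_desc _ _ _, hleft, .of_left' hpo hleft⟩
end

section
/- Let f : [m] → [p], g : [m] → [q], h : [p] → [n], k : [q] → [n] form a pushout square in Δ (h∘f = k∘g and the square is a pushout of the span (f, g)). If f is injective or g is surjective, then δ_k ≤ δ_f. -/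
open CategoryTheory CategoryTheory.Limits SimplexCategory

namespace DefectPushout

/-- The elements of `X` that are not the greatest element of their fiber under `u`. -/
def nonMaxFiber {X Y : Type*} [LinearOrder X] (u : X → Y) : Set X :=
  {x | ∃ y, x < y ∧ u y = u x}

lemma card_eq_ncard_range_add_ncard_nonMaxFiber {X Y : Type*} [LinearOrder X] [Finite X]
    (u : X → Y) : Nat.card X = (Set.range u).ncard + (nonMaxFiber u).ncard := by
  have hinj : Set.InjOn u (nonMaxFiber u)ᶜ := by
    intro a ha b hb hab
    rcases lt_trichotomy a b with h | h | h
    · exact absurd ⟨b, h, hab.symm⟩ ha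
    · exact h
    · exact absurd ⟨a, h, hab⟩ hb
  have himage : Set.image u (nonMaxFiber u)ᶜ = Set.range u := by
    refine subset_antisymm (Set.image_subset_range _ _) ?_
    rintro _ ⟨x, rfl⟩
    obtain ⟨y, hy, hmax⟩ :=
      Set.exists_max_image {y | u y = u x} id (Set.toFinite _) ⟨x, rfl⟩
    refine ⟨y, ?_, hy⟩
    rintro ⟨z, hyz, hz⟩
    exact absurd (hmax z (hz.trans hy)) (not_le.mpr hyz)
  rw [← himage, hinj.ncard_image, add_comm, Set.ncard_add_ncard_compl]

lemma ncard_nonMaxFiber_le {P A B C : Type*} [LinearOrder P] [LinearOrder A] [LinearOrder B]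
    [Finite A] {a : P → A} {b : P → B} {u : A → C} {v : B → C} (ha : Monotone a) (hb : Monotone b)
    (comm : ∀ x, u (a x) = v (b x)) (joint : ∀ x y, a x = a y → b x = b y → x = y) :
    (nonMaxFiber b).ncard ≤ (nonMaxFiber u).ncard := by
  have lift_lt {x y : P} (h : x < y) (hxy : b y = b x) : a x < a y :=
    (ha h.le).lt_of_ne fun e => h.ne (joint _ _ e hxy.symm)
  have no_lt {x y : P} (hx : x ∈ nonMaxFiber b) (hxy : a x = a y) : ¬ x < y := by
    intro h
    obtain ⟨z, hxz, hz⟩ := hx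
    rcases le_total z y with hzy | hyz
    · exact absurd (ha hzy) (not_le.mpr (hxy ▸ lift_lt hxz hz))
    · exact h.ne (joint _ _ hxy ((hb h.le).antisymm (hz ▸ hb hyz)))
  refine Set.ncard_le_ncard_of_injOn a ?_ ?_ (Set.toFinite _)
  · rintro x ⟨y, hxy, hy⟩
    exact ⟨a y, lift_lt hxy hy, by rw [comm, comm, hy]⟩
  · intro x hx y hy hxy
    exact le_antisymm (not_lt.mp (no_lt hy hxy.symm)) (not_lt.mp (no_lt hx hxy))

lemma ncard_compl_range_le {P A B C : Type*} [Finite C] {b : P → B} {u : A → C} {v : B → C}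
    (exist : ∀ x y, u x = v y → ∃ z, b z = y)
    (huv : Function.Surjective u ∨ Function.Injective v) :
    (Set.range b)ᶜ.ncard ≤ (Set.range u)ᶜ.ncard := by
  have hmaps : Set.MapsTo v (Set.range b)ᶜ (Set.range u)ᶜ := by
    rintro y hy ⟨x, hx⟩
    exact hy (exist x y hx)
  rcases huv with hu | hv
  · have hempty : (Set.range b)ᶜ = ∅ :=
      Set.eq_empty_of_forall_notMem fun y hy => hmaps hy (hu (v y))
    simp [hempty]
  · exact Set.ncard_le_ncard_of_injOn v hmaps hv.injOn (Set.toFinite _)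

/-- The pointwise order on the morphisms to `[1]`, which is total. -/
noncomputable instance homMkOneLinearOrder (x : SimplexCategory) :
    LinearOrder (x ⟶ SimplexCategory.mk 1) :=
  { PartialOrder.lift (fun φ : x ⟶ SimplexCategory.mk 1 => φ.toOrderHom)
      (fun _ _ h => SimplexCategory.Hom.ext _ _ h) with
    le_total := by
      intro φ ψ
      change φ.toOrderHom ≤ ψ.toOrderHom ∨ ψ.toOrderHom ≤ φ.toOrderHom
      by_contra! hne
      obtain ⟨h₁, h₂⟩ := hne
      simp only [OrderHom.le_def, not_forall, not_le] at h₁ h₂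
      obtain ⟨i, hi⟩ := h₁
      obtain ⟨j, hj⟩ := h₂
      have hφi := (φ.toOrderHom i).isLt
      have hψj := (ψ.toOrderHom j).isLt
      simp only [SimplexCategory.len_mk] at hφi hψj
      rw [Fin.lt_def] at hi hj
      rcases le_total i j with hij | hij
      · have hle := Fin.le_def.mp (φ.toOrderHom.monotone hij)
        lia
      · have hle := Fin.le_def.mp (ψ.toOrderHom.monotone hij)
        lia
    toDecidableLE := Classical.decRel _ }

/-- Restriction of morphisms to `[1]` along `f`. -/
def restrict {x y : SimplexCategory} (f : x ⟶ y) (φ : y ⟶ SimplexCategory.mk 1) :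
    x ⟶ SimplexCategory.mk 1 :=
  f ≫ φ

lemma restrict_monotone {x y : SimplexCategory} (f : x ⟶ y) : Monotone (restrict f) :=
  fun _ _ h i => h (f.toOrderHom i)

lemma card_hom_mk_one (x : SimplexCategory) : Nat.card (x ⟶ SimplexCategory.mk 1) = x.len + 2 := by
  rw [← Nat.card_congr (SimplexCategory.toMk₁Equiv (n := x.len)), Nat.card_fin]

lemma restrict_injective {x y : SimplexCategory} (f : x ⟶ y) [Epi f] :
    Function.Injective (restrict f) :=
  fun _ _ h => (cancel_epi f).mp h

lemma restrict_surjective {x y : SimplexCategory} (f : x ⟶ y)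
    (hf : Function.Injective f.toOrderHom) : Function.Surjective (restrict f) := by
  intro φ
  obtain ⟨s, rfl⟩ := SimplexCategory.toMk₁_surjective (n := x.len) φ
  have hmono : StrictMono f.toOrderHom := f.toOrderHom.monotone.strictMono_of_injective hf
  suffices ∃ t : Fin (y.len + 2), ∀ i, (f.toOrderHom i).castSucc < t ↔ i.castSucc < s by
    obtain ⟨t, ht⟩ := this
    refine ⟨SimplexCategory.toMk₁ (n := y.len) t, SimplexCategory.Hom.ext _ _ ?_⟩
    ext i : 2
    change (if (f.toOrderHom i).castSucc < t then (0 : Fin 2) else 1) =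
      if i.castSucc < s then 0 else 1
    simp only [ht]
  induction s using Fin.lastCases with
  | last => exact ⟨Fin.last _, fun i => by simp [Fin.castSucc_lt_last]⟩
  | cast s =>
    exact ⟨(f.toOrderHom s).castSucc, fun i => by
      simp only [Fin.castSucc_lt_castSucc_iff, hmono.lt_iff_lt]⟩

lemma ncard_range_restrict {x y : SimplexCategory} (f : x ⟶ y) :
    (Set.range (restrict f)).ncard = (Finset.image f.toOrderHom Finset.univ).card + 1 := by
  have hι : Function.Injective (image.ι f).toOrderHom :=
    SimplexCategory.mono_iff_injective.mp inferInstance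
  have he : Function.Surjective (factorThruImage f).toOrderHom :=
    SimplexCategory.epi_iff_surjective.mp inferInstance
  have hcomp : restrict f = restrict (factorThruImage f) ∘ restrict (image.ι f) := by
    funext φ
    simp [restrict]
  have hfun : (f.toOrderHom : _ → _) =
      (image.ι f).toOrderHom ∘ (factorThruImage f).toOrderHom := by
    conv_lhs => rw [← image.fac f]
    rfl
  rw [hcomp, (restrict_surjective _ hι).range_comp, ← Set.image_univ,
    Set.ncard_image_of_injective _ (restrict_injective _), Set.ncard_univ, card_hom_mk_one,
    hfun, ← Finset.image_image, Finset.image_univ_of_surjective he,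
    Finset.card_image_of_injective _ hι, Finset.card_univ, Fintype.card_fin]

lemma defect_eq {x y : SimplexCategory} (f : x ⟶ y) :
    defect f = (nonMaxFiber (restrict f)).ncard + (Set.range (restrict f))ᶜ.ncard := by
  have h₁ := card_eq_ncard_range_add_ncard_nonMaxFiber (restrict f)
  have h₂ := Set.ncard_add_ncard_compl (Set.range (restrict f))
  rw [card_hom_mk_one] at h₁ h₂
  rw [ncard_range_restrict] at h₁ h₂
  unfold defect
  lia

end DefectPushout

open DefectPushout in
/-- In a pushout square in `Δ` whose top map `f` is injective (a coface map)
or whose left map `g` is surjective (a codegeneracy map), the defect of the bottom map `k` is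
at most the defect of the top map `f`. -/
theorem defect_le_of_pushout {m p q n : ℕ}
    (f : SimplexCategory.mk m ⟶ SimplexCategory.mk p)
    (g : SimplexCategory.mk m ⟶ SimplexCategory.mk q)
    (h : SimplexCategory.mk p ⟶ SimplexCategory.mk n)
    (k : SimplexCategory.mk q ⟶ SimplexCategory.mk n)
    (hpo : IsPushout f g h k)
    (hfg : Function.Injective f.toOrderHom ∨ Function.Surjective g.toOrderHom) :
    defect k ≤ defect f := by
  rw [defect_eq, defect_eq]
  refine add_le_add
    (ncard_nonMaxFiber_le (restrict_monotone h) (restrict_monotone k) (v := restrict g)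
      (fun φ => by simp [restrict, hpo.w_assoc]) (fun _ _ => hpo.hom_ext))
    (ncard_compl_range_le (v := restrict g)
      (fun φ ψ e => ⟨hpo.desc φ ψ e, hpo.inr_desc φ ψ e⟩) ?_)
  refine hfg.imp (restrict_surjective f) fun hg => ?_
  have : Epi g := SimplexCategory.epi_iff_surjective.mpr hg
  exact restrict_injective g
end

section
/- Let X : Δ^op → Set be a simplicial set. Suppose X sends to weak pullbacks: (i) for every n ≥ 0 and 0 ≤ i ≤ n, the square with top d^{i+1} : [n+1] → [n+2], left s^i : [n+1] → [n], right s^i∘s^i : [n+2] → [n], and bottom the identity of [n]; and (ii) for every n ≥ 2 and 0 ≤ i ≤ n−2, the square with top d^i : [n−2] → [n−1], left d^i : [n−2] → [n−1], right d^{i+1} : [n−1] → [n], and bottom d^i : [n−1] → [n]. Then X is discrete: X(f) is a bijection for every morphism f in Δ. -/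
open CategoryTheory SimplexCategory

universe u

/-- A simplicial set `X` sends the commuting square in `Δ` with top `f`, left `g`,
right `h`, bottom `k` to a weak pullback of sets. -/
def SendsToWeakPullback (X : SimplexCategoryᵒᵖ ⥤ Type u)
    {w x y z : SimplexCategory} (f : w ⟶ x) (g : w ⟶ y) (h : x ⟶ z) (k : y ⟶ z) : Prop :=
  ∀ (b : X.obj (Opposite.op x)) (c : X.obj (Opposite.op y)),
    X.map f.op b = X.map g.op c →
    ∃ a : X.obj (Opposite.op z), X.map h.op a = b ∧ X.map k.op a = c

/-- If a simplicial set sends the listed squares to weak pullbacks,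
then it is discrete. -/
theorem discrete_of_weakPullbacks (X : SimplexCategoryᵒᵖ ⥤ Type u)
    (h1 : ∀ (n : ℕ) (i : Fin (n + 1)),
      SendsToWeakPullback X (δ i.succ.castSucc) (σ i)
        (σ i.castSucc ≫ σ i) (𝟙 (SimplexCategory.mk n)))
    (h2 : ∀ (n : ℕ) (i : Fin (n + 1)),
      SendsToWeakPullback X (δ i.castSucc) (δ i.castSucc)
        (δ i.succ.castSucc) (δ i.castSucc.castSucc)) :
    ∀ {x y : SimplexCategory} (f : x ⟶ y), Function.Bijective (X.map f.op) := by
  have hs : ∀ (n : ℕ) (i : Fin (n + 1)), IsIso (X.map (σ i).op) := by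
    intro n i
    have h_left : X.map (σ i).op ≫ X.map (δ i.castSucc).op = 𝟙 _ := by
      rw [← X.map_comp, ← op_comp, δ_comp_σ_self, op_id, X.map_id]
    have h_right : X.map (δ i.castSucc).op ≫ X.map (σ i).op = 𝟙 _ := by
      ext c
      obtain ⟨a, ha, rfl⟩ := h2 n i (X.map (σ i).op (X.map (δ i.castSucc).op c)) c
        (ConcreteCategory.congr_hom h_left _)
      obtain ⟨c', hc, _⟩ := h1 n i a _ ha
      have hδ : δ i.castSucc.castSucc ≫ σ i.castSucc ≫ σ i = σ i := by
        rw [δ_comp_σ_self_assoc]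
      have hc' : X.map (δ i.castSucc.castSucc).op a = X.map (σ i).op c' := by
        rw [← hc, ← ConcreteCategory.comp_apply, ← X.map_comp, ← op_comp, hδ]
      change X.map (σ i).op (X.map (δ i.castSucc).op (X.map (δ i.castSucc.castSucc).op a)) =
        X.map (δ i.castSucc.castSucc).op a
      rw [hc']
      exact congrArg (X.map (σ i).op) (ConcreteCategory.congr_hom h_left c')
    exact ⟨_, h_left, h_right⟩
  have hd : ∀ (n : ℕ) (i : Fin (n + 2)), IsIso (X.map (δ i).op) := by
    intro n i
    obtain ⟨j, hj⟩ : ∃ j : Fin (n + 1), δ i ≫ σ j = 𝟙 _ := by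
      cases i using Fin.lastCases with
      | last => exact ⟨Fin.last n, δ_comp_σ_succ⟩
      | cast j => exact ⟨j, δ_comp_σ_self⟩
    have := hs n j
    have h_comp : X.map (σ j).op ≫ X.map (δ i).op = 𝟙 _ := by
      rw [← X.map_comp, ← op_comp, hj, op_id, X.map_id]
    have : IsIso (X.map (σ j).op ≫ X.map (δ i).op) := by rw [h_comp]; infer_instance
    exact IsIso.of_isIso_comp_left (X.map (σ j).op) _
  have h_top := morphismProperty_eq_top
    (((MorphismProperty.isomorphisms (Type u)).inverseImage X).unop)
    (fun i => hd _ i) (fun i => hs _ i)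
  intro x y f
  have hf : ((MorphismProperty.isomorphisms (Type u)).inverseImage X).unop f :=
    h_top ▸ MorphismProperty.top_apply f
  exact (isIso_iff_bijective _).1 hf
end

section
/- Let X : Δ^op → Set be a simplicial set which, for all a, b ≥ 0, sends to a pullback of sets the square with top [0] → [a] (0 ↦ a), left [0] → [b] (0 ↦ 0), right the inclusion [a] → [a+b] (j ↦ j), and bottom [b] → [a+b] (j ↦ a+j). Let Q₁ = (f₁, g₁, h₁, k₁) and Q₂ = (f₂, g₂, h₂, k₂) be commuting squares in Δ such that all four maps of Q₁ preserve the maximum element and all four maps of Q₂ preserve the minimum element, so the ∨-product square Q₁∨Q₂ = (f₁∨f₂, g₁∨g₂, h₁∨h₂, k₁∨k₂) exists. If X sends Q₁ and Q₂ to pullbacks of sets, then X sends Q₁∨Q₂ to a pullback of sets. -/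
open CategoryTheory SimplexCategory

universe u

/-- A simplicial set `X` sends the commuting square in `Δ` with top `f`, left `g`,
right `h`, bottom `k` to a (strong) pullback of sets. -/
def SendsToPullback (X : SimplexCategoryᵒᵖ ⥤ Type u)
    {w x y z : SimplexCategory} (f : w ⟶ x) (g : w ⟶ y) (h : x ⟶ z) (k : y ⟶ z) : Prop :=
  ∀ (b : X.obj (Opposite.op x)) (c : X.obj (Opposite.op y)),
    X.map f.op b = X.map g.op c →
    ∃! a : X.obj (Opposite.op z), X.map h.op a = b ∧ X.map k.op a = c

/-- The binary `∨`-product of monotone maps: `(f ∨ g)(j) = f(j)` for `j ≤ a₀` and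
`(f ∨ g)(a₀ + j) = b₀ + g(j)` for `0 ≤ j ≤ a₁`. -/
def vee {a₀ b₀ a₁ b₁ : ℕ} (f : Fin (a₀ + 1) →o Fin (b₀ + 1)) (g : Fin (a₁ + 1) →o Fin (b₁ + 1)) :
    Fin (a₀ + a₁ + 1) →o Fin (b₀ + b₁ + 1) where
  toFun x :=
    if hx : (x : ℕ) ≤ a₀ then
      ⟨f ⟨x, by omega⟩, by have := (f ⟨(x : ℕ), by omega⟩).isLt; omega⟩
    else
      ⟨b₀ + g ⟨(x : ℕ) - a₀, by have := x.isLt; omega⟩,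
        by have := (g ⟨(x : ℕ) - a₀, by have := x.isLt; omega⟩).isLt; omega⟩
  monotone' := by
    intro x y hxy
    have hxy' : (x : ℕ) ≤ (y : ℕ) := hxy
    by_cases hx : (x : ℕ) ≤ a₀ <;> by_cases hy : (y : ℕ) ≤ a₀
    · simp only [dif_pos hx, dif_pos hy, Fin.mk_le_mk]
      exact Fin.le_def.mp (f.monotone (Fin.mk_le_mk.mpr hxy'))
    · simp only [dif_pos hx, dif_neg hy, Fin.mk_le_mk]
      have := (f ⟨(x : ℕ), by omega⟩).is_le
      omega
    · omega
    · simp only [dif_neg hx, dif_neg hy, Fin.mk_le_mk]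
      have := Fin.le_def.mp (g.monotone (a := ⟨(x : ℕ) - a₀, by have := x.isLt; omega⟩)
        (b := ⟨(y : ℕ) - a₀, by have := y.isLt; omega⟩) (Fin.mk_le_mk.mpr (by omega)))
      omega

/-- The inclusion `[a] → [a+b]`, `j ↦ j`. -/
def inclLeft (a b : ℕ) : SimplexCategory.mk a ⟶ SimplexCategory.mk (a + b) :=
  SimplexCategory.mkHom
    ⟨fun j => ⟨j, by have := j.isLt; omega⟩,
     fun s t hst => by simp only [Fin.mk_le_mk]; exact hst⟩

/-- The inclusion `[b] → [a+b]`, `j ↦ a + j`. -/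
def inclRight (a b : ℕ) : SimplexCategory.mk b ⟶ SimplexCategory.mk (a + b) :=
  SimplexCategory.mkHom
    ⟨fun j => ⟨a + j, by have := j.isLt; omega⟩,
     fun s t hst => by simp only [Fin.mk_le_mk]; exact Nat.add_le_add_left hst a⟩

theorem inclLeft_comp_vee {a₀ b₀ a₁ b₁ : ℕ}
    (f : SimplexCategory.mk a₀ ⟶ SimplexCategory.mk b₀)
    (g : SimplexCategory.mk a₁ ⟶ SimplexCategory.mk b₁) :
    inclLeft a₀ a₁ ≫ SimplexCategory.mkHom (vee f.toOrderHom g.toOrderHom) =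
      f ≫ inclLeft b₀ b₁ := by
  apply SimplexCategory.Hom.ext
  ext j
  have hj : (j : ℕ) ≤ a₀ := Nat.le_of_lt_succ j.isLt
  change ((vee f.toOrderHom g.toOrderHom ⟨j, _⟩ : Fin _) : ℕ) = (f.toOrderHom j : ℕ)
  simp [vee, hj]

theorem inclRight_comp_vee {a₀ b₀ a₁ b₁ : ℕ}
    (f : SimplexCategory.mk a₀ ⟶ SimplexCategory.mk b₀)
    (g : SimplexCategory.mk a₁ ⟶ SimplexCategory.mk b₁)
    (hf : f.toOrderHom (Fin.last a₀) = Fin.last b₀) (hg : g.toOrderHom 0 = 0) :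
    inclRight a₀ a₁ ≫ SimplexCategory.mkHom (vee f.toOrderHom g.toOrderHom) =
      g ≫ inclRight b₀ b₁ := by
  apply SimplexCategory.Hom.ext
  ext j
  change ((vee f.toOrderHom g.toOrderHom ⟨a₀ + j, _⟩ : Fin _) : ℕ) = b₀ + (g.toOrderHom j : ℕ)
  by_cases hj : j = 0
  · subst hj
    have hlast := congrArg Fin.val hf
    have hzero := congrArg Fin.val hg
    simp_all [vee, Fin.last]
  · have hj' : (j : ℕ) ≠ 0 := fun h => hj (Fin.ext h)
    simp [vee, hj']

theorem const_last_comp_inclLeft (a b : ℕ) :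
    SimplexCategory.const (SimplexCategory.mk 0) (SimplexCategory.mk a) (Fin.last a) ≫
        inclLeft a b =
      SimplexCategory.const (SimplexCategory.mk 0) (SimplexCategory.mk b) 0 ≫
        inclRight a b :=
  rfl

theorem const_comp_of_map_eq {a b : ℕ} (f : SimplexCategory.mk a ⟶ SimplexCategory.mk b)
    {i : Fin (a + 1)} {j : Fin (b + 1)} (hf : f.toOrderHom i = j) :
    SimplexCategory.const (SimplexCategory.mk 0) (SimplexCategory.mk a) i ≫ f =
      SimplexCategory.const (SimplexCategory.mk 0) (SimplexCategory.mk b) j := by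
  subst hf
  rfl

theorem map_op_map_op (X : SimplexCategoryᵒᵖ ⥤ Type u) {x y z : SimplexCategory}
    (f : x ⟶ y) (g : y ⟶ z) (a : X.obj (Opposite.op z)) :
    X.map f.op (X.map g.op a) = X.map (f ≫ g).op a := by
  simp

theorem SendsToPullback.ext {X : SimplexCategoryᵒᵖ ⥤ Type u} {w x y z : SimplexCategory}
    {f : w ⟶ x} {g : w ⟶ y} {h : x ⟶ z} {k : y ⟶ z} (hQ : SendsToPullback X f g h k)
    (comm : f ≫ h = g ≫ k) {a a' : X.obj (Opposite.op z)}
    (hl : X.map h.op a = X.map h.op a') (hr : X.map k.op a = X.map k.op a') : a = a' :=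
  (hQ _ _ (by rw [map_op_map_op, map_op_map_op, comm])).unique ⟨hl, hr⟩ ⟨rfl, rfl⟩

/-- If `X` sends all the initial-final squares to pullbacks of sets,
then the squares sent by `X` to pullbacks of sets are closed under binary `∨`-products. -/
theorem sendsToPullback_vee (X : SimplexCategoryᵒᵖ ⥤ Type u)
    (hX : ∀ a b : ℕ,
      SendsToPullback X
        (SimplexCategory.const (SimplexCategory.mk 0) (SimplexCategory.mk a) (Fin.last a))
        (SimplexCategory.const (SimplexCategory.mk 0) (SimplexCategory.mk b) 0)
        (inclLeft a b) (inclRight a b))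
    {m₁ p₁ q₁ n₁ m₂ p₂ q₂ n₂ : ℕ}
    (f₁ : SimplexCategory.mk m₁ ⟶ SimplexCategory.mk p₁)
    (g₁ : SimplexCategory.mk m₁ ⟶ SimplexCategory.mk q₁)
    (h₁ : SimplexCategory.mk p₁ ⟶ SimplexCategory.mk n₁)
    (k₁ : SimplexCategory.mk q₁ ⟶ SimplexCategory.mk n₁)
    (f₂ : SimplexCategory.mk m₂ ⟶ SimplexCategory.mk p₂)
    (g₂ : SimplexCategory.mk m₂ ⟶ SimplexCategory.mk q₂)
    (h₂ : SimplexCategory.mk p₂ ⟶ SimplexCategory.mk n₂)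
    (k₂ : SimplexCategory.mk q₂ ⟶ SimplexCategory.mk n₂)
    (comm₁ : f₁ ≫ h₁ = g₁ ≫ k₁) (comm₂ : f₂ ≫ h₂ = g₂ ≫ k₂)
    (hf₁ : f₁.toOrderHom (Fin.last m₁) = Fin.last p₁)
    (hg₁ : g₁.toOrderHom (Fin.last m₁) = Fin.last q₁)
    (hh₁ : h₁.toOrderHom (Fin.last p₁) = Fin.last n₁)
    (hk₁ : k₁.toOrderHom (Fin.last q₁) = Fin.last n₁)
    (hf₂ : f₂.toOrderHom 0 = 0) (hg₂ : g₂.toOrderHom 0 = 0)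
    (hh₂ : h₂.toOrderHom 0 = 0) (hk₂ : k₂.toOrderHom 0 = 0)
    (hQ₁ : SendsToPullback X f₁ g₁ h₁ k₁) (hQ₂ : SendsToPullback X f₂ g₂ h₂ k₂) :
    SendsToPullback X
      (SimplexCategory.mkHom (vee f₁.toOrderHom f₂.toOrderHom))
      (SimplexCategory.mkHom (vee g₁.toOrderHom g₂.toOrderHom))
      (SimplexCategory.mkHom (vee h₁.toOrderHom h₂.toOrderHom))
      (SimplexCategory.mkHom (vee k₁.toOrderHom k₂.toOrderHom)) := by
  have hvl {a₀ b₀ a₁ b₁ : ℕ} (f : SimplexCategory.mk a₀ ⟶ SimplexCategory.mk b₀)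
      (g : SimplexCategory.mk a₁ ⟶ SimplexCategory.mk b₁) (a) :
      X.map (inclLeft a₀ a₁).op
          (X.map (SimplexCategory.mkHom (vee f.toOrderHom g.toOrderHom)).op a) =
        X.map f.op (X.map (inclLeft b₀ b₁).op a) := by
    rw [map_op_map_op, map_op_map_op, inclLeft_comp_vee]
  have hvr {a₀ b₀ a₁ b₁ : ℕ} (f : SimplexCategory.mk a₀ ⟶ SimplexCategory.mk b₀)
      (g : SimplexCategory.mk a₁ ⟶ SimplexCategory.mk b₁)
      (hf : f.toOrderHom (Fin.last a₀) = Fin.last b₀) (hg : g.toOrderHom 0 = 0) (a) :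
      X.map (inclRight a₀ a₁).op
          (X.map (SimplexCategory.mkHom (vee f.toOrderHom g.toOrderHom)).op a) =
        X.map g.op (X.map (inclRight b₀ b₁).op a) := by
    rw [map_op_map_op, map_op_map_op, inclRight_comp_vee f g hf hg]
  intro b c hbc
  have e₁ : X.map f₁.op (X.map (inclLeft p₁ p₂).op b) =
      X.map g₁.op (X.map (inclLeft q₁ q₂).op c) := by
    rw [← hvl f₁ f₂, ← hvl g₁ g₂, hbc]
  have e₂ : X.map f₂.op (X.map (inclRight p₁ p₂).op b) =
      X.map g₂.op (X.map (inclRight q₁ q₂).op c) := by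
    rw [← hvr f₁ f₂ hf₁ hf₂, ← hvr g₁ g₂ hg₁ hg₂, hbc]
  obtain ⟨a₁, ⟨hb₁, hc₁⟩, -⟩ := hQ₁ _ _ e₁
  obtain ⟨a₂, ⟨hb₂, hc₂⟩, -⟩ := hQ₂ _ _ e₂
  have e : X.map (SimplexCategory.const (SimplexCategory.mk 0) (SimplexCategory.mk n₁)
        (Fin.last n₁)).op a₁ =
      X.map (SimplexCategory.const (SimplexCategory.mk 0) (SimplexCategory.mk n₂) 0).op a₂ := by
    rw [← const_comp_of_map_eq h₁ hh₁, ← const_comp_of_map_eq h₂ hh₂, ← map_op_map_op,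
      ← map_op_map_op, hb₁, hb₂, map_op_map_op, map_op_map_op, const_last_comp_inclLeft]
  obtain ⟨a, ⟨ha₁, ha₂⟩, -⟩ := hX n₁ n₂ _ _ e
  refine ⟨a, ⟨(hX p₁ p₂).ext (const_last_comp_inclLeft _ _) ?_ ?_,
    (hX q₁ q₂).ext (const_last_comp_inclLeft _ _) ?_ ?_⟩, ?_⟩
  · rw [hvl h₁ h₂, ha₁, hb₁]
  · rw [hvr h₁ h₂ hh₁ hh₂, ha₂, hb₂]
  · rw [hvl k₁ k₂, ha₁, hc₁]
  · rw [hvr k₁ k₂ hk₁ hk₂, ha₂, hc₂]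
  · rintro a' ⟨hb, hc⟩
    refine (hX n₁ n₂).ext (const_last_comp_inclLeft _ _)
      (hQ₁.ext comm₁ ?_ ?_) (hQ₂.ext comm₂ ?_ ?_)
    · rw [ha₁, hb₁, ← hvl h₁ h₂, hb]
    · rw [ha₁, hc₁, ← hvl k₁ k₂, hc]
    · rw [ha₂, hb₂, ← hvr h₁ h₂ hh₁ hh₂, hb]
    · rw [ha₂, hc₂, ← hvr k₁ k₂ hk₁ hk₂, hc]
end

section
/- Let X : Δ^op → Set be a simplicial set. Then X sends every pushout square in Δ to a pullback of sets if and only if X sends to pullbacks of sets: (i) for all a, b ≥ 0, the square with top [0] → [a] (0 ↦ a), left [0] → [b] (0 ↦ 0), right the inclusion [a] → [a+b] (j ↦ j), and bottom [b] → [a+b] (j ↦ a+j); and (ii) the square with top d¹ : [1] → [2], left s⁰ : [1] → [0], right the unique map [2] → [0], and bottom the identity of [0]. -/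
open CategoryTheory CategoryTheory.Limits SimplexCategory

universe u

open Opposite Simplicial

section Combinatorics

/-- The order-theoretic content of a pushout square of finite linear orders: `h` and `k` are jointly
surjective, and compatible upper sets of `P` and `Q` come from an upper set of `N`. -/
structure IsSeparatedCocone {M P Q N : Type*} [LinearOrder M] [LinearOrder P] [LinearOrder Q]
    [LinearOrder N] (f : M →o P) (g : M →o Q) (h : P →o N) (k : Q →o N) : Prop where
  comm : ∀ i, h (f i) = k (g i)
  cover : ∀ j, (∃ x, h x = j) ∨ ∃ y, k y = j
  separate : ∀ (U : UpperSet P) (V : UpperSet Q), (∀ i, f i ∈ U ↔ g i ∈ V) →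
    ∃ W : UpperSet N, (∀ x, h x ∈ W ↔ x ∈ U) ∧ ∀ y, k y ∈ W ↔ y ∈ V

namespace IsSeparatedCocone

variable {M P Q N : Type*} [LinearOrder M] [LinearOrder P] [LinearOrder Q] [LinearOrder N]
  {f : M →o P} {g : M →o Q} {h : P →o N} {k : Q →o N}

theorem symm (H : IsSeparatedCocone f g h k) : IsSeparatedCocone g f k h where
  comm i := (H.comm i).symm
  cover j := (H.cover j).symm
  separate U V hUV := by
    obtain ⟨W, h₁, h₂⟩ := H.separate V U fun i => (hUV i).symm
    exact ⟨W, h₂, h₁⟩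

theorem exists_apply_eq (H : IsSeparatedCocone f g h k) {x : P} {y : Q} (hxy : h x = k y) :
    ∃ i, h (f i) = h x := by
  by_contra! hne
  obtain ⟨W, hU, hV⟩ := H.separate
    ⟨{z | h x ≤ h z}, fun _ _ hab ha => le_trans ha (h.monotone hab)⟩
    ⟨{z | h x < k z}, fun _ _ hab ha => lt_of_lt_of_le ha (k.monotone hab)⟩ fun i => by
      change h x ≤ h (f i) ↔ h x < k (g i)
      rw [← H.comm]
      exact ⟨fun hi => lt_of_le_of_ne hi (hne i).symm, le_of_lt⟩
  have hx : h x ∈ W := (hU x).2 (le_refl (h x))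
  rw [hxy] at hx
  have hy : h x < k y := (hV y).1 hx
  exact hy.ne hxy

theorem exists_of_apply_eq (H : IsSeparatedCocone f g h k) {x x' : P} (hlt : x < x')
    (hxx' : h x = h x') : ∃ i l, i ≤ l ∧ f i ≤ x ∧ x < f l ∧ g i = g l := by
  by_contra! hne
  obtain ⟨W, hU, -⟩ := H.separate
    ⟨{z | x < z}, fun _ _ hab ha => lt_of_lt_of_le ha hab⟩
    ⟨{z | ∃ l, x < f l ∧ g l ≤ z}, fun _ _ hab ⟨l, hl, hl'⟩ => ⟨l, hl, hl'.trans hab⟩⟩ fun i => by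
      change x < f i ↔ ∃ l, x < f l ∧ g l ≤ g i
      refine ⟨fun hi => ⟨i, hi, le_rfl⟩, fun ⟨l, hl, hl'⟩ => ?_⟩
      by_contra! hi
      have hil : i ≤ l := by
        by_contra! hli
        exact absurd (f.monotone hli.le) (hi.trans_lt hl).not_ge
      exact hne i l hil hi hl (le_antisymm (g.monotone hil) hl')
  have hx' : h x' ∈ W := (hU x').2 hlt
  rw [← hxx'] at hx'
  exact lt_irrefl x ((hU x).1 hx')

theorem exists_of_apply_covBy (H : IsSeparatedCocone f g h k) {x : P} {y : Q}
    (hcov : h x ⋖ k y) : (∃ x', h x' = k y) ∨ ∃ y', k y' = h x := by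
  by_contra! hne
  obtain ⟨hP, hQ⟩ := hne
  obtain ⟨W, hU, hV⟩ := H.separate
    ⟨{z | h x ≤ h z}, fun _ _ hab ha => le_trans ha (h.monotone hab)⟩
    ⟨{z | k y < k z}, fun _ _ hab ha => lt_of_lt_of_le ha (k.monotone hab)⟩ fun i => by
      change h x ≤ h (f i) ↔ k y < k (g i)
      have h₁ := hP (f i)
      have h₂ := hQ (g i)
      rw [H.comm] at *
      refine ⟨fun hi => lt_of_le_of_ne ?_ h₁.symm, fun hi => (hcov.lt.trans hi).le⟩
      exact hcov.ge_of_gt (lt_of_le_of_ne hi h₂.symm)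
  have hx : h x ∈ W := (hU x).2 (le_refl (h x))
  exact lt_irrefl (k y) ((hV y).1 (W.upper hcov.le hx))

theorem exists_of_covBy (H : IsSeparatedCocone f g h k) {j j' : N} (hcov : j ⋖ j') :
    (∃ x x', h x = j ∧ h x' = j') ∨ ∃ y y', k y = j ∧ k y' = j' := by
  rcases H.cover j with ⟨x, rfl⟩ | ⟨y, rfl⟩ <;> rcases H.cover j' with ⟨x', rfl⟩ | ⟨y', rfl⟩
  · exact .inl ⟨x, x', rfl, rfl⟩
  · rcases H.exists_of_apply_covBy hcov with ⟨x', hx'⟩ | ⟨y, hy⟩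
    · exact .inl ⟨x, x', rfl, hx'⟩
    · exact .inr ⟨y, y', hy, rfl⟩
  · rcases H.symm.exists_of_apply_covBy hcov with ⟨y', hy'⟩ | ⟨x, hx⟩
    · exact .inr ⟨y, y', rfl, hy'⟩
    · exact .inl ⟨x, x', hx, rfl⟩
  · exact .inr ⟨y, y', rfl, rfl⟩

end IsSeparatedCocone

open Classical in
/-- The classifying map of an upper set of `[n]`. -/
noncomputable def upperSetHom {n : ℕ} (U : UpperSet (Fin (n + 1))) : ⦋n⦌ ⟶ ⦋1⦌ :=
  SimplexCategory.mkHom ⟨fun x => if x ∈ U then 1 else 0, fun a b hab => by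
    dsimp only
    split_ifs with ha hb
    · exact le_rfl
    · exact absurd (U.upper hab ha) hb
    · exact Fin.zero_le _
    · exact le_rfl⟩

open Classical in
theorem upperSetHom_apply {n : ℕ} (U : UpperSet (Fin (n + 1))) (x : Fin (n + 1)) :
    (upperSetHom U).toOrderHom x = if x ∈ U then 1 else 0 :=
  rfl

theorem upperSetHom_apply_eq_one_iff {n : ℕ} (U : UpperSet (Fin (n + 1))) (x : Fin (n + 1)) :
    (upperSetHom U).toOrderHom x = 1 ↔ x ∈ U := by
  rw [upperSetHom_apply]
  split_ifs with hx <;> simp [hx]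

theorem upperSetHom_apply_eq_iff {n n' : ℕ} (U : UpperSet (Fin (n + 1)))
    (V : UpperSet (Fin (n' + 1))) (x : Fin (n + 1)) (y : Fin (n' + 1)) :
    (upperSetHom U).toOrderHom x = (upperSetHom V).toOrderHom y ↔ (x ∈ U ↔ y ∈ V) := by
  rw [upperSetHom_apply, upperSetHom_apply]
  split_ifs with hx hy hy <;> simp [hx, hy]

theorem isSeparatedCocone_of_isPushout {m p q n : ℕ} {f : ⦋m⦌ ⟶ ⦋p⦌} {g : ⦋m⦌ ⟶ ⦋q⦌}
    {h : ⦋p⦌ ⟶ ⦋n⦌} {k : ⦋q⦌ ⟶ ⦋n⦌} (H : IsPushout f g h k) :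
    IsSeparatedCocone f.toOrderHom g.toOrderHom h.toOrderHom k.toOrderHom where
  comm i := DFunLike.congr_fun (congrArg SimplexCategory.Hom.toOrderHom H.w) i
  cover j := by
    by_contra! hne
    obtain ⟨hP, hQ⟩ := hne
    have heq : upperSetHom (UpperSet.Ici j) = upperSetHom (UpperSet.Ioi j) := by
      apply H.hom_ext <;> ext x : 3
      · refine (upperSetHom_apply_eq_iff _ _ _ _).2 ?_
        rw [UpperSet.mem_Ici_iff, UpperSet.mem_Ioi_iff]
        exact ⟨fun hi => lt_of_le_of_ne hi (hP x).symm, le_of_lt⟩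
      · refine (upperSetHom_apply_eq_iff _ _ _ _).2 ?_
        rw [UpperSet.mem_Ici_iff, UpperSet.mem_Ioi_iff]
        exact ⟨fun hi => lt_of_le_of_ne hi (hQ x).symm, le_of_lt⟩
    have := (upperSetHom_apply_eq_iff _ _ j j).1
      (DFunLike.congr_fun (congrArg SimplexCategory.Hom.toOrderHom heq) j)
    simp at this
  separate U V hUV := by
    have hw : f ≫ upperSetHom U = g ≫ upperSetHom V := by
      ext i : 3
      exact (upperSetHom_apply_eq_iff _ _ _ _).2 (hUV i)
    let φ := H.desc _ _ hw
    refine ⟨⟨{j | φ.toOrderHom j = 1}, fun a b hab ha => ?_⟩, fun x => ?_, fun y => ?_⟩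
    · exact le_antisymm (Fin.le_last _) (le_trans (le_of_eq (Eq.symm ha)) (φ.toOrderHom.monotone hab))
    · rw [← upperSetHom_apply_eq_one_iff U, ← H.inl_desc _ _ hw]
      rfl
    · rw [← upperSetHom_apply_eq_one_iff V, ← H.inr_desc _ _ hw]
      rfl

end Combinatorics

section Edges

variable {X : SimplexCategoryᵒᵖ ⥤ Type u}

theorem map_map_eq_map {l m n : SimplexCategory} (φ : l ⟶ m) (ψ : m ⟶ n) (χ : l ⟶ n)
    (hχ : φ ≫ ψ = χ) (a : X.obj (op n)) : X.map φ.op (X.map ψ.op a) = X.map χ.op a := by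
  rw [← hχ, op_comp, Functor.map_comp_apply]

/-- The edge of a simplex between two of its vertices. -/
def edge {n : ℕ} (a : X.obj (op ⦋n⦌)) {i j : Fin (n + 1)} (hij : i ≤ j) : X.obj (op ⦋1⦌) :=
  X.map (mkOfLe i j hij).op a

theorem edge_congr {n : ℕ} (a : X.obj (op ⦋n⦌)) {i j i' j' : Fin (n + 1)} (hij : i ≤ j)
    (hi : i = i') (hj : j = j') : edge a hij = edge a (hi ▸ hj ▸ hij : i' ≤ j') := by
  subst hi hj
  rfl

theorem edge_map {m n : ℕ} (φ : ⦋m⦌ ⟶ ⦋n⦌) (a : X.obj (op ⦋n⦌)) {i j : Fin (m + 1)}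
    (hij : i ≤ j) : edge (X.map φ.op a) hij = edge a (φ.toOrderHom.monotone hij) :=
  map_map_eq_map _ _ _ (Hom.ext_one_left _ _) a

theorem map_eq_edge {n : ℕ} (a : X.obj (op ⦋n⦌)) (φ : ⦋1⦌ ⟶ ⦋n⦌) :
    X.map φ.op a = edge a (φ.toOrderHom.monotone (Fin.zero_le 1)) := by
  rw [edge, ← Hom.ext_one_left φ (mkOfLe _ _ (φ.toOrderHom.monotone (Fin.zero_le 1))) rfl rfl]

theorem edge_edge {n : ℕ} (a : X.obj (op ⦋n⦌)) {i j : Fin (n + 1)} (hij : i ≤ j)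
    {s t : Fin 2} (hst : s ≤ t) :
    edge (edge a hij) hst = edge a ((mkOfLe i j hij).toOrderHom.monotone hst) :=
  edge_map _ a hst

theorem edge_edge_zero {n : ℕ} (a : X.obj (op ⦋n⦌)) {i j : Fin (n + 1)} (hij : i ≤ j) :
    edge (edge a hij) (le_refl (0 : Fin 2)) = edge a (le_refl i) :=
  edge_edge a hij _

theorem edge_edge_one {n : ℕ} (a : X.obj (op ⦋n⦌)) {i j : Fin (n + 1)} (hij : i ≤ j) :
    edge (edge a hij) (le_refl (1 : Fin 2)) = edge a (le_refl j) :=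
  edge_edge a hij _

theorem map_const_edge {n : ℕ} (a : X.obj (op ⦋n⦌)) (i : Fin (n + 1)) :
    X.map (SimplexCategory.const ⦋0⦌ ⦋1⦌ 0).op (edge a (le_refl i)) =
      X.map (SimplexCategory.const ⦋0⦌ ⦋n⦌ i).op a :=
  map_map_eq_map _ _ _ (Hom.ext_zero_left _ _ rfl) a

theorem edge_eq_right_of_eq_left {n : ℕ} {a : X.obj (op ⦋n⦌)} {i j : Fin (n + 1)} {hij : i ≤ j}
    (h : edge a hij = edge a (le_refl i)) : edge a hij = edge a (le_refl j) := by
  rw [← edge_edge_one a hij, h, edge_edge_one]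

/-- The Segal condition: `X` sends the initial-final squares to pullbacks. -/
def IsSegal (X : SimplexCategoryᵒᵖ ⥤ Type u) : Prop :=
  ∀ a b : ℕ, SendsToPullback X
    (SimplexCategory.const (SimplexCategory.mk 0) (SimplexCategory.mk a) (Fin.last a))
    (SimplexCategory.const (SimplexCategory.mk 0) (SimplexCategory.mk b) 0)
    (inclLeft a b) (inclRight a b)

namespace IsSegal

theorem ext (hS : IsSegal X) {n : ℕ} {a a' : X.obj (op ⦋n⦌)}
    (h : ∀ (i j : Fin (n + 1)) (hij : i ≤ j), (j : ℕ) ≤ i + 1 → edge a hij = edge a' hij) :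
    a = a' := by
  induction n with
  | zero =>
    have h₀ := congrArg (X.map (SimplexCategory.const ⦋0⦌ ⦋1⦌ 0).op) (h 0 0 le_rfl (by simp))
    rw [map_const_edge, map_const_edge] at h₀
    have hid : SimplexCategory.const ⦋0⦌ ⦋0⦌ 0 = 𝟙 _ := Hom.ext_zero_left _ _ rfl
    rwa [hid, op_id, Functor.map_id_apply, Functor.map_id_apply] at h₀
  | succ n ih =>
    have hl : X.map (inclLeft n 1).op a = X.map (inclLeft n 1).op a' := by
      refine ih fun i j hij hji => ?_
      rw [edge_map, edge_map]
      exact h _ _ _ hji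
    have hr : X.map (inclRight n 1).op a = X.map (inclRight n 1).op a' := by
      rw [map_eq_edge, map_eq_edge]
      exact h _ _ _ (le_refl (n + 1))
    refine (hS n 1 _ _ ?_).unique ⟨rfl, rfl⟩ ⟨hl.symm, hr.symm⟩
    rw [map_map_eq_map _ _ _ rfl, map_map_eq_map _ _ _ rfl]
    congr 3

theorem edge_trans (hS : IsSegal X) {n n' : ℕ} {a : X.obj (op ⦋n⦌)} {a' : X.obj (op ⦋n'⦌)}
    {i j l : Fin (n + 1)} {i' j' l' : Fin (n' + 1)} {hij : i ≤ j} {hjl : j ≤ l}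
    {hij' : i' ≤ j'} {hjl' : j' ≤ l'} (h₁ : edge a hij = edge a' hij')
    (h₂ : edge a hjl = edge a' hjl') :
    edge a (hij.trans hjl) = edge a' (hij'.trans hjl') := by
  have h₁₀ := congrArg (edge · (le_refl (0 : Fin 2))) h₁
  have h₁₁ := congrArg (edge · (le_refl (1 : Fin 2))) h₁
  have h₂₁ := congrArg (edge · (le_refl (1 : Fin 2))) h₂
  simp only [edge_edge_zero, edge_edge_one] at h₁₀ h₁₁ h₂₁
  have key : X.map (mkOfLeComp i j l hij hjl).op a =
      X.map (mkOfLeComp i' j' l' hij' hjl').op a' := by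
    refine hS.ext fun s t hst hts => ?_
    rw [edge_map, edge_map]
    fin_cases s <;> fin_cases t
    · exact h₁₀
    · exact h₁
    · exact absurd hts (by decide)
    · exact absurd hst (by decide)
    · exact h₁₁
    · exact h₂
    · exact absurd hst (by decide)
    · exact absurd hst (by decide)
    · exact h₂₁
  have := congrArg (edge · (Fin.zero_le (2 : Fin 3))) key
  simp only [edge_map] at this
  exact this

theorem edge_eq_of_left (hS : IsSegal X) {n : ℕ} {a : X.obj (op ⦋n⦌)} {i j l : Fin (n + 1)}
    {hij : i ≤ j} (hjl : j ≤ l) (h : edge a hij = edge a (le_refl i)) :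
    edge a (hij.trans hjl) = edge a hjl :=
  hS.edge_trans (hij' := le_refl j) (hjl := hjl) (edge_eq_right_of_eq_left h) rfl

theorem edge_eq_of_right (hS : IsSegal X) {n : ℕ} {a : X.obj (op ⦋n⦌)} {i j l : Fin (n + 1)}
    (hij : i ≤ j) {hjl : j ≤ l} (h : edge a hjl = edge a (le_refl j)) :
    edge a (hij.trans hjl) = edge a hij :=
  hS.edge_trans (hij := hij) (hjl' := le_refl j) rfl h

/-- A simplex of a Segal set can be assembled from compatible vertices and consecutive edges. -/
theorem exists_of_edges (hS : IsSegal X) {n : ℕ}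
    (R : Fin (n + 1) → Fin (n + 1) → X.obj (op ⦋1⦌) → Prop)
    (hR : ∀ i j : Fin (n + 1), i ≤ j → (j : ℕ) ≤ i + 1 → ∃ e, R i j e)
    (hzero : ∀ i j e, R i j e → R i i (edge e (le_refl (0 : Fin 2))))
    (hone : ∀ i j e, R i j e → R j j (edge e (le_refl (1 : Fin 2))))
    (huniq : ∀ i e e', R i i e → R i i e' → e = e') :
    ∃ a : X.obj (op ⦋n⦌), ∀ (i j : Fin (n + 1)) (hij : i ≤ j), (j : ℕ) ≤ i + 1 →
      R i j (edge a hij) := by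
  induction n with
  | zero =>
    obtain ⟨e, he⟩ := hR 0 0 le_rfl (by simp)
    refine ⟨X.map (SimplexCategory.const ⦋0⦌ ⦋1⦌ 0).op e, fun i j hij _ => ?_⟩
    rw [edge_map]
    obtain rfl := Fin.fin_one_eq_zero i
    obtain rfl := Fin.fin_one_eq_zero j
    exact hzero _ _ _ he
  | succ n ih =>
    obtain ⟨a, ha⟩ := ih (fun i j => R i.castSucc j.castSucc)
      (fun i j hij hji => hR _ _ hij hji) (fun i j => hzero _ _) (fun i j => hone _ _)
      (fun i => huniq _)
    obtain ⟨e, he⟩ := hR (Fin.last n).castSucc (Fin.last (n + 1)) (Fin.le_last _) (le_refl (n + 1))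
    have hae := huniq _ _ _ (ha (Fin.last n) (Fin.last n) le_rfl (by simp)) (hzero _ _ _ he)
    have hae' := congrArg (X.map (SimplexCategory.const ⦋0⦌ ⦋1⦌ 0).op) hae
    rw [map_const_edge, map_const_edge] at hae'
    obtain ⟨z, ⟨hl, hr⟩, -⟩ := hS n 1 a e hae'
    have hze : edge z (Fin.le_last (Fin.last n).castSucc) = e := by
      rw [← hr, map_eq_edge]
      rfl
    refine ⟨z, fun i j hij hji => ?_⟩
    induction j using Fin.lastCases with
    | cast j =>
      obtain ⟨i, rfl⟩ : ∃ i' : Fin (n + 1), i = i'.castSucc :=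
        ⟨⟨i, lt_of_le_of_lt hij j.isLt⟩, rfl⟩
      have := ha i j hij hji
      rw [← hl, edge_map] at this
      exact this
    | last =>
      have hi : i = (Fin.last n).castSucc ∨ i = Fin.last (n + 1) := by
        simp only [Fin.ext_iff, Fin.val_last, Fin.val_castSucc] at *
        have := i.isLt
        omega
      rcases hi with rfl | rfl
      · rw [hze]
        exact he
      · have := hone _ _ _ he
        rw [← hze, edge_edge_one] at this
        exact this

end IsSegal

/-- In `X`, if a composite edge is degenerate then so are its factors. -/
def HasTrivialFactors (X : SimplexCategoryᵒᵖ ⥤ Type u) : Prop :=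
  SendsToPullback X (δ (1 : Fin 3)) (σ (0 : Fin 1))
    (SimplexCategory.const (SimplexCategory.mk 2) (SimplexCategory.mk 0) 0)
    (𝟙 (SimplexCategory.mk 0))

theorem HasTrivialFactors.edge_eq (hT : HasTrivialFactors X) {n : ℕ} {a : X.obj (op ⦋n⦌)}
    {i j l : Fin (n + 1)} (hij : i ≤ j) (hjl : j ≤ l)
    (h : edge a (hij.trans hjl) = edge a (le_refl i)) :
    edge a hij = edge a (le_refl i) ∧ edge a hjl = edge a (le_refl j) := by
  obtain ⟨v, ⟨hv, -⟩, -⟩ := hT (X.map (mkOfLeComp i j l hij hjl).op a)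
    (X.map (SimplexCategory.const ⦋0⦌ ⦋n⦌ i).op a) (by
      rw [map_eq_edge, edge_map, map_eq_edge, edge_map]
      exact h)
  have key {s t s' t' : Fin 3} (hst : s ≤ t) (hst' : s' ≤ t') :
      edge (X.map (mkOfLeComp i j l hij hjl).op a) hst =
        edge (X.map (mkOfLeComp i j l hij hjl).op a) hst' := by
    rw [← hv, edge_map, edge_map]
    rfl
  have h₁ := key (Fin.zero_le 1) (le_refl 0)
  have h₂ := key (show (1 : Fin 3) ≤ 2 by decide) (le_refl 1)
  rw [edge_map, edge_map] at h₁ h₂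
  exact ⟨h₁, h₂⟩

end Edges

section Amalgamation

variable {X : SimplexCategoryᵒᵖ ⥤ Type u} {m p q n : ℕ}
  {f : Fin (m + 1) →o Fin (p + 1)} {g : Fin (m + 1) →o Fin (q + 1)}
  {h : Fin (p + 1) →o Fin (n + 1)} {k : Fin (q + 1) →o Fin (n + 1)}
  {b : X.obj (op ⦋p⦌)} {c : X.obj (op ⦋q⦌)}

/-- Two simplices with the same restriction along `f` and `g`. -/
def AgreeOnEdges (f : Fin (m + 1) →o Fin (p + 1)) (g : Fin (m + 1) →o Fin (q + 1))
    (b : X.obj (op ⦋p⦌)) (c : X.obj (op ⦋q⦌)) : Prop :=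
  ∀ (i l : Fin (m + 1)) (hil : i ≤ l), edge b (f.monotone hil) = edge c (g.monotone hil)

theorem AgreeOnEdges.symm (hbc : AgreeOnEdges f g b c) : AgreeOnEdges g f c b :=
  fun i l hil => (hbc i l hil).symm

/-- `e` is the image in an amalgam of an edge of `b` or `c`, lying over `(j, l)`. -/
def IsEdgeOver (h : Fin (p + 1) →o Fin (n + 1)) (k : Fin (q + 1) →o Fin (n + 1))
    (b : X.obj (op ⦋p⦌)) (c : X.obj (op ⦋q⦌)) (j l : Fin (n + 1)) (e : X.obj (op ⦋1⦌)) : Prop :=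
  (∃ x x', ∃ hx : x ≤ x', h x = j ∧ h x' = l ∧ e = edge b hx) ∨
    ∃ y y', ∃ hy : y ≤ y', k y = j ∧ k y' = l ∧ e = edge c hy

namespace IsEdgeOver

variable {j l : Fin (n + 1)} {e : X.obj (op ⦋1⦌)}

theorem symm (he : IsEdgeOver h k b c j l e) : IsEdgeOver k h c b j l e :=
  Or.symm he

theorem left {x x' : Fin (p + 1)} (hx : x ≤ x') :
    IsEdgeOver h k b c (h x) (h x') (edge b hx) :=
  .inl ⟨x, x', hx, rfl, rfl, rfl⟩

theorem right {y y' : Fin (q + 1)} (hy : y ≤ y') :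
    IsEdgeOver h k b c (k y) (k y') (edge c hy) :=
  .inr ⟨y, y', hy, rfl, rfl, rfl⟩

theorem source (he : IsEdgeOver h k b c j l e) :
    IsEdgeOver h k b c j j (edge e (le_refl (0 : Fin 2))) := by
  rcases he with ⟨x, x', hx, rfl, rfl, rfl⟩ | ⟨y, y', hy, rfl, rfl, rfl⟩
  · rw [edge_edge_zero]
    exact left _
  · rw [edge_edge_zero]
    exact right _

theorem target (he : IsEdgeOver h k b c j l e) :
    IsEdgeOver h k b c l l (edge e (le_refl (1 : Fin 2))) := by
  rcases he with ⟨x, x', hx, rfl, rfl, rfl⟩ | ⟨y, y', hy, rfl, rfl, rfl⟩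
  · rw [edge_edge_one]
    exact left _
  · rw [edge_edge_one]
    exact right _

end IsEdgeOver

namespace IsSeparatedCocone

theorem exists_isEdgeOver (H : IsSeparatedCocone f g h k) (b : X.obj (op ⦋p⦌))
    (c : X.obj (op ⦋q⦌)) {j l : Fin (n + 1)} (hjl : j ≤ l) (hlj : (l : ℕ) ≤ j + 1) :
    ∃ e, IsEdgeOver h k b c j l e := by
  rcases hjl.eq_or_lt with rfl | hlt
  · rcases H.cover j with ⟨x, rfl⟩ | ⟨y, rfl⟩
    · exact ⟨_, .left (le_refl x)⟩
    · exact ⟨_, .right (le_refl y)⟩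
  · have hcov : j ⋖ l := ⟨hlt, fun t ht ht' => by
      simp only [Fin.lt_def] at *
      omega⟩
    rcases H.exists_of_covBy hcov with ⟨x, x', rfl, rfl⟩ | ⟨y, y', rfl, rfl⟩
    · exact ⟨_, .left (h.monotone.reflect_lt hlt).le⟩
    · exact ⟨_, .right (k.monotone.reflect_lt hlt).le⟩

/-- An edge of `b` passing over an intermediate vertex is determined by its two parts. -/
theorem edge_eq_of_split (hS : IsSegal X) {a : X.obj (op ⦋n⦌)} {d : ℕ}
    (ih : ∀ (j l : Fin (n + 1)) (hjl : j ≤ l), (l : ℕ) < j + d → ∀ e,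
      IsEdgeOver h k b c j l e → e = edge a hjl)
    {x t x' : Fin (p + 1)} (hx : x ≤ x') (hd : (h x' : ℕ) = h x + d) (hxt : h x < h t)
    (htx' : h t < h x') : edge b hx = edge a (h.monotone hx) := by
  have h₁ := (h.monotone.reflect_lt hxt).le
  have h₂ := (h.monotone.reflect_lt htx').le
  simp only [Fin.lt_def] at hxt htx'
  exact hS.edge_trans (ih _ _ (h.monotone h₁) (by omega) _ (.left h₁))
    (ih _ _ (h.monotone h₂) (by omega) _ (.left h₂))

variable (hS : IsSegal X) (hT : HasTrivialFactors X)
include hS hT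

theorem edge_eq_of_apply_eq (H : IsSeparatedCocone f g h k) (hbc : AgreeOnEdges f g b c)
    {x x' : Fin (p + 1)} (hx : x ≤ x') (hxx' : h x = h x') :
    edge b hx = edge b (le_refl x) := by
  obtain ⟨d, hd⟩ : ∃ d : ℕ, (x' : ℕ) = x + d := ⟨x' - x, by have : (x : ℕ) ≤ x' := hx; omega⟩
  induction d generalizing x' with
  | zero =>
    obtain rfl : x = x' := Fin.ext (by omega)
    rfl
  | succ d ih =>
    let t : Fin (p + 1) := ⟨x + d, by omega⟩
    have hxt : x ≤ t := Nat.le_add_right _ _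
    have htx' : t < x' := by
      change (x : ℕ) + d < x'
      omega
    have hht : h t = h x' :=
      le_antisymm (h.monotone htx'.le) (hxx' ▸ h.monotone hxt)
    have h₁ := ih hxt (hxx'.trans hht.symm) rfl
    obtain ⟨i, l, hil, hi, hl, hgil⟩ := H.exists_of_apply_eq htx' hht
    have hl' : x' ≤ f l := by
      change (x' : ℕ) ≤ f l
      have : (x : ℕ) + d < f l := hl
      omega
    have hconst : edge b (f.monotone hil) = edge b (le_refl (f i)) := by
      rw [hbc i l hil, hbc i i le_rfl]
      exact edge_congr c _ rfl hgil.symm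
    have h₂ := (hT.edge_eq (hi.trans htx'.le) hl' hconst).1
    have h₃ := (hT.edge_eq hi htx'.le h₂).2
    rw [hS.edge_eq_of_left htx'.le h₁, h₃, ← edge_eq_right_of_eq_left h₁, h₁]

theorem edge_eq_edge_left (H : IsSeparatedCocone f g h k) (hbc : AgreeOnEdges f g b c)
    {x x' z z' : Fin (p + 1)} (hx : x ≤ x') (hz : z ≤ z') (h₁ : h x = h z) (h₂ : h x' = h z') :
    edge b hx = edge b hz := by
  have key {x x' z z' : Fin (p + 1)} (hx : x ≤ x') (hzx : z ≤ x) (hxz' : x' ≤ z')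
      (h₁ : h z = h x) (h₂ : h x' = h z') :
      edge b ((hzx.trans hx).trans hxz') = edge b hx := by
    rw [hS.edge_eq_of_right (hzx.trans hx) (H.edge_eq_of_apply_eq hS hT hbc hxz' h₂),
      hS.edge_eq_of_left hx (H.edge_eq_of_apply_eq hS hT hbc hzx h₁)]
  rw [← key (z := min x z) (z' := max x' z') hx (min_le_left _ _) (le_max_left _ _)
      (by rcases min_choice x z with h | h <;> simp [h, h₁])
      (by rcases max_choice x' z' with h | h <;> simp [h, h₂]),
    ← key (z := min x z) (z' := max x' z') hz (min_le_right _ _) (le_max_right _ _)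
      (by rcases min_choice x z with h | h <;> simp [h, h₁])
      (by rcases max_choice x' z' with h | h <;> simp [h, h₂])]

theorem edge_eq_edge (H : IsSeparatedCocone f g h k) (hbc : AgreeOnEdges f g b c)
    {x x' : Fin (p + 1)} {y y' : Fin (q + 1)} (hx : x ≤ x') (hy : y ≤ y') (h₁ : h x = k y)
    (h₂ : h x' = k y') : edge b hx = edge c hy := by
  obtain ⟨i, l, hil, hi, hl⟩ : ∃ i l, i ≤ l ∧ h (f i) = h x ∧ h (f l) = h x' := by
    obtain ⟨i, hi⟩ := H.exists_apply_eq h₁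
    obtain ⟨l, hl⟩ := H.exists_apply_eq h₂
    rcases le_total i l with hil | hli
    · exact ⟨i, l, hil, hi, hl⟩
    · refine ⟨i, i, le_rfl, hi, hi.trans (le_antisymm (h.monotone hx) ?_)⟩
      rw [← hi, ← hl]
      exact h.monotone (f.monotone hli)
  rw [H.edge_eq_edge_left hS hT hbc hx (f.monotone hil) hi.symm hl.symm, hbc i l hil]
  refine H.symm.edge_eq_edge_left hS hT hbc.symm _ _ ?_ ?_
  · rw [← H.comm, hi, h₁]
  · rw [← H.comm, hl, h₂]

theorem isEdgeOver_unique (H : IsSeparatedCocone f g h k) (hbc : AgreeOnEdges f g b c)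
    {j l : Fin (n + 1)} {e e' : X.obj (op ⦋1⦌)} (he : IsEdgeOver h k b c j l e)
    (he' : IsEdgeOver h k b c j l e') : e = e' := by
  rcases he with ⟨x, x', hx, rfl, rfl, rfl⟩ | ⟨y, y', hy, rfl, rfl, rfl⟩ <;>
    rcases he' with ⟨z, z', hz, h₁, h₂, rfl⟩ | ⟨z, z', hz, h₁, h₂, rfl⟩
  · exact H.edge_eq_edge_left hS hT hbc _ _ h₁.symm h₂.symm
  · exact H.edge_eq_edge hS hT hbc _ _ h₁.symm h₂.symm
  · exact (H.edge_eq_edge hS hT hbc _ _ h₁ h₂).symm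
  · exact H.symm.edge_eq_edge_left hS hT hbc.symm _ _ h₁.symm h₂.symm

theorem edge_eq_of_two_le (H : IsSeparatedCocone f g h k) (hbc : AgreeOnEdges f g b c)
    {a : X.obj (op ⦋n⦌)} {d : ℕ} (hd₂ : 2 ≤ d)
    (ih : ∀ (j l : Fin (n + 1)) (hjl : j ≤ l), (l : ℕ) < j + d → ∀ e,
      IsEdgeOver h k b c j l e → e = edge a hjl)
    {x x' : Fin (p + 1)} (hx : x ≤ x') (hd : (h x' : ℕ) = h x + d) :
    edge b hx = edge a (h.monotone hx) := by
  by_cases ht : ∃ t, h x < h t ∧ h t < h x'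
  · obtain ⟨t, hxt, htx'⟩ := ht
    exact edge_eq_of_split hS ih hx hd hxt htx'
  · push Not at ht
    have hlt := (h x').isLt
    obtain ⟨y, t, hy, hyt⟩ : ∃ y t, k y = h x ∧ (k t : ℕ) = h x + 1 := by
      have hcov : h x ⋖ (⟨h x + 1, by omega⟩ : Fin (n + 1)) :=
        ⟨Fin.lt_def.2 (Nat.lt_succ_self _), fun s hs hs' => by
          simp only [Fin.lt_def] at *
          omega⟩
      rcases H.exists_of_covBy hcov with ⟨z, t, -, hz⟩ | ⟨y, t, hy, hyt⟩
      · have := ht t (hz ▸ hcov.lt)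
        rw [hz, Fin.le_def] at this
        dsimp only at this
        omega
      · exact ⟨y, t, hy, congrArg Fin.val hyt⟩
    obtain ⟨y', hy'⟩ : ∃ y', k y' = h x' := by
      have hcov : (⟨h x' - 1, by omega⟩ : Fin (n + 1)) ⋖ h x' :=
        ⟨Fin.lt_def.2 (by dsimp only; omega), fun s hs hs' => by
          simp only [Fin.lt_def] at *
          omega⟩
      rcases H.exists_of_covBy hcov with ⟨t, z, hz, -⟩ | ⟨t, y', -, hy'⟩
      · have := ht t (by rw [hz, Fin.lt_def]; dsimp only; omega)
        rw [hz] at this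
        exact absurd hcov.lt this.not_gt
      · exact ⟨y', hy'⟩
    have hyy' : y ≤ y' := (k.monotone.reflect_lt (by rw [hy, hy', Fin.lt_def]; omega)).le
    rw [H.edge_eq_edge hS hT hbc hx hyy' hy.symm hy'.symm,
      edge_eq_of_split hS (fun j l hjl hd e he => ih j l hjl hd e he.symm) hyy'
        (by rw [hy, hy', hd]) (by rw [hy, Fin.lt_def]; omega : k y < k t)
        (by rw [hy', Fin.lt_def]; omega)]
    exact edge_congr a _ hy hy'

theorem eq_edge_of_isEdgeOver (H : IsSeparatedCocone f g h k) (hbc : AgreeOnEdges f g b c)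
    {a : X.obj (op ⦋n⦌)}
    (ha : ∀ (j l : Fin (n + 1)) (hjl : j ≤ l), (l : ℕ) ≤ j + 1 →
      IsEdgeOver h k b c j l (edge a hjl))
    {j l : Fin (n + 1)} (hjl : j ≤ l) {e : X.obj (op ⦋1⦌)} (he : IsEdgeOver h k b c j l e) :
    e = edge a hjl := by
  obtain ⟨d, hd⟩ : ∃ d : ℕ, (l : ℕ) = j + d := ⟨l - j, by have : (j : ℕ) ≤ l := hjl; omega⟩
  induction d using Nat.strong_induction_on generalizing j l e with
  | _ d ih =>
    have ih' (j l : Fin (n + 1)) (hjl : j ≤ l) (hlt : (l : ℕ) < j + d) (e)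
        (he : IsEdgeOver h k b c j l e) : e = edge a hjl := by
      have : (j : ℕ) ≤ l := hjl
      exact ih (l - j) (by omega) hjl he (by omega)
    rcases le_or_gt d 1 with hd₁ | hd₂
    · exact H.isEdgeOver_unique hS hT hbc he (ha j l hjl (by omega))
    · rcases he with ⟨x, x', hx, rfl, rfl, rfl⟩ | ⟨y, y', hy, rfl, rfl, rfl⟩
      · exact H.edge_eq_of_two_le hS hT hbc hd₂ ih' hx hd
      · exact H.symm.edge_eq_of_two_le hS hT hbc.symm hd₂
          (fun j l hjl hd e he => ih' j l hjl hd e he.symm) hy hd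

end IsSeparatedCocone

end Amalgamation

theorem sendsToPullback_of_isSeparatedCocone {X : SimplexCategoryᵒᵖ ⥤ Type u} (hS : IsSegal X)
    (hT : HasTrivialFactors X) {m p q n : ℕ} {f : ⦋m⦌ ⟶ ⦋p⦌} {g : ⦋m⦌ ⟶ ⦋q⦌} {h : ⦋p⦌ ⟶ ⦋n⦌}
    {k : ⦋q⦌ ⟶ ⦋n⦌}
    (H : IsSeparatedCocone f.toOrderHom g.toOrderHom h.toOrderHom k.toOrderHom) :
    SendsToPullback X f g h k := by
  intro b c hbc
  have hbc' : AgreeOnEdges f.toOrderHom g.toOrderHom b c := fun i l hil => by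
    rw [← edge_map f b hil, ← edge_map g c hil, hbc]
  obtain ⟨a, ha⟩ := hS.exists_of_edges (IsEdgeOver h.toOrderHom k.toOrderHom b c)
    (fun i j => H.exists_isEdgeOver b c) (fun i j e => IsEdgeOver.source)
    (fun i j e => IsEdgeOver.target) (fun i e e' => H.isEdgeOver_unique hS hT hbc')
  refine ⟨a, ⟨hS.ext fun i j hij _ => ?_, hS.ext fun i j hij _ => ?_⟩, fun a' ⟨hb, hc⟩ => ?_⟩
  · rw [edge_map]
    exact (H.eq_edge_of_isEdgeOver hS hT hbc' ha _ (.left hij)).symm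
  · rw [edge_map]
    exact (H.eq_edge_of_isEdgeOver hS hT hbc' ha _ (.right hij)).symm
  · refine hS.ext fun i j hij hji => ?_
    rcases ha i j hij hji with ⟨x, x', hx, rfl, rfl, he⟩ | ⟨y, y', hy, rfl, rfl, he⟩
    · rw [he, ← hb, edge_map]
    · rw [he, ← hc, edge_map]

theorem inclLeft_apply_mk {a b : ℕ} (j : Fin (a + b + 1)) (hj : (j : ℕ) ≤ a) :
    (inclLeft a b).toOrderHom ⟨j, Nat.lt_succ_of_le hj⟩ = j :=
  rfl

theorem inclRight_apply_mk {a b : ℕ} (j : Fin (a + b + 1)) (hj : a ≤ (j : ℕ)) :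
    (inclRight a b).toOrderHom ⟨j - a, by have := j.isLt; dsimp; omega⟩ = j :=
  Fin.ext (Nat.add_sub_cancel' hj)

/-- The map out of `[a + b]` glued from maps out of `[a]` and `[b]`. -/
def glueHom {a b : ℕ} {z : SimplexCategory} (u : ⦋a⦌ ⟶ z) (v : ⦋b⦌ ⟶ z)
    (huv : u.toOrderHom (Fin.last a) = v.toOrderHom 0) : ⦋a + b⦌ ⟶ z :=
  SimplexCategory.mkHom ⟨fun j => if hj : (j : ℕ) ≤ a
    then u.toOrderHom ⟨j, Nat.lt_succ_of_le hj⟩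
    else v.toOrderHom ⟨j - a, by have := j.isLt; dsimp; omega⟩, fun i j hij => by
      have hij' : (i : ℕ) ≤ j := hij
      dsimp only
      split_ifs with hi hj hj
      · exact u.toOrderHom.monotone hij
      · exact (u.toOrderHom.monotone (Fin.le_last _)).trans
          (huv.trans_le (v.toOrderHom.monotone (Fin.zero_le _)))
      · omega
      · exact v.toOrderHom.monotone (Nat.sub_le_sub_right hij' a)⟩

theorem inclLeft_glueHom {a b : ℕ} {z : SimplexCategory} (u : ⦋a⦌ ⟶ z) (v : ⦋b⦌ ⟶ z)
    (huv : u.toOrderHom (Fin.last a) = v.toOrderHom 0) : inclLeft a b ≫ glueHom u v huv = u := by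
  ext j : 3
  exact dif_pos (Nat.le_of_lt_succ j.isLt)

theorem inclRight_glueHom {a b : ℕ} {z : SimplexCategory} (u : ⦋a⦌ ⟶ z) (v : ⦋b⦌ ⟶ z)
    (huv : u.toOrderHom (Fin.last a) = v.toOrderHom 0) :
    inclRight a b ≫ glueHom u v huv = v := by
  ext j : 3
  by_cases hj : j = 0
  · subst hj
    exact (dif_pos (le_refl a)).trans huv
  · have hj' : 0 < (j : ℕ) := Nat.pos_of_ne_zero fun h => hj (Fin.ext h)
    refine (dif_neg (show ¬a + (j : ℕ) ≤ a by omega)).trans ?_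
    exact congrArg v.toOrderHom (Fin.ext (Nat.add_sub_cancel_left a j))

theorem hom_ext_of_incl {a b : ℕ} {z : SimplexCategory} {φ ψ : ⦋a + b⦌ ⟶ z}
    (hl : inclLeft a b ≫ φ = inclLeft a b ≫ ψ) (hr : inclRight a b ≫ φ = inclRight a b ≫ ψ) :
    φ = ψ := by
  ext j : 3
  rcases le_total (j : ℕ) a with hj | hj
  · rw [← inclLeft_apply_mk j hj]
    exact DFunLike.congr_fun (congrArg SimplexCategory.Hom.toOrderHom hl) _
  · rw [← inclRight_apply_mk j hj]
    exact DFunLike.congr_fun (congrArg SimplexCategory.Hom.toOrderHom hr) _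

theorem isPushout_initialFinal (a b : ℕ) :
    IsPushout
      (SimplexCategory.const (SimplexCategory.mk 0) (SimplexCategory.mk a) (Fin.last a))
      (SimplexCategory.const (SimplexCategory.mk 0) (SimplexCategory.mk b) 0)
      (inclLeft a b) (inclRight a b) := by
  have hs (s : PushoutCocone
      (SimplexCategory.const (SimplexCategory.mk 0) (SimplexCategory.mk a) (Fin.last a))
      (SimplexCategory.const (SimplexCategory.mk 0) (SimplexCategory.mk b) 0)) :
      s.inl.toOrderHom (Fin.last a) = s.inr.toOrderHom 0 :=
    DFunLike.congr_fun (congrArg SimplexCategory.Hom.toOrderHom s.condition) 0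
  exact ⟨⟨Hom.ext_zero_left _ _ rfl⟩, ⟨PushoutCocone.IsColimit.mk _
    (fun s => glueHom s.inl s.inr (hs s)) (fun s => inclLeft_glueHom _ _ _)
    (fun s => inclRight_glueHom _ _ _) fun s φ hl hr => hom_ext_of_incl
      (hl.trans (inclLeft_glueHom _ _ _).symm) (hr.trans (inclRight_glueHom _ _ _).symm)⟩⟩

theorem isPushout_δ_one_σ_zero :
    IsPushout (δ (1 : Fin 3)) (σ (0 : Fin 1))
      (SimplexCategory.const (SimplexCategory.mk 2) (SimplexCategory.mk 0) 0)
      (𝟙 (SimplexCategory.mk 0)) := by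
  refine ⟨⟨Hom.ext_one_left _ _ rfl rfl⟩, ⟨PushoutCocone.IsColimit.mk _
    (fun s => s.inr) (fun s => ?_) (fun s => Category.id_comp _)
    (fun s φ _ hφ => (Category.id_comp φ).symm.trans hφ)⟩⟩
  have hw (i : Fin 2) : s.inl.toOrderHom ((δ (1 : Fin 3)).toOrderHom i) = s.inr.toOrderHom 0 :=
    (DFunLike.congr_fun (congrArg SimplexCategory.Hom.toOrderHom s.condition) i).trans
      (congrArg s.inr.toOrderHom (Subsingleton.elim (α := Fin 1) _ _))
  have h₀ : s.inl.toOrderHom 0 = s.inr.toOrderHom 0 := hw 0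
  have h₂ : s.inl.toOrderHom 2 = s.inr.toOrderHom 0 := hw 1
  have h₁ : s.inl.toOrderHom 1 = s.inr.toOrderHom 0 :=
    le_antisymm (h₂ ▸ s.inl.toOrderHom.monotone (show (1 : Fin 3) ≤ 2 by decide))
      (h₀ ▸ s.inl.toOrderHom.monotone (show (0 : Fin 3) ≤ 1 by decide))
  ext i : 3
  fin_cases i
  · exact h₀.symm
  · exact h₁.symm
  · exact h₂.symm

/-- A simplicial set `X` sends every pushout square in `Δ` to a pullback of
sets if and only if it sends to pullbacks of sets (i) all initial-final squares and (ii) the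
square with top `d¹ : [1] → [2]`, left `s⁰ : [1] → [0]`, right the unique map `[2] → [0]`,
and bottom the identity of `[0]`. -/
theorem sendsAllPushoutsToPullbacks_iff (X : SimplexCategoryᵒᵖ ⥤ Type u) :
    (∀ {w x y z : SimplexCategory} (f : w ⟶ x) (g : w ⟶ y) (h : x ⟶ z) (k : y ⟶ z),
        IsPushout f g h k → SendsToPullback X f g h k) ↔
      ((∀ a b : ℕ,
          SendsToPullback X
            (SimplexCategory.const (SimplexCategory.mk 0) (SimplexCategory.mk a) (Fin.last a))
            (SimplexCategory.const (SimplexCategory.mk 0) (SimplexCategory.mk b) 0)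
            (inclLeft a b) (inclRight a b)) ∧
        SendsToPullback X (δ (1 : Fin 3)) (σ (0 : Fin 1))
          (SimplexCategory.const (SimplexCategory.mk 2) (SimplexCategory.mk 0) 0)
          (𝟙 (SimplexCategory.mk 0))) := by

  refine ⟨fun H => ⟨fun a b => H _ _ _ _ (isPushout_initialFinal a b),
    H _ _ _ _ isPushout_δ_one_σ_zero⟩, fun ⟨hS, hT⟩ w x y z f g h k H => ?_⟩
  exact sendsToPullback_of_isSeparatedCocone (m := w.len) (p := x.len) (q := y.len) (n := z.len)
    hS hT (isSeparatedCocone_of_isPushout H)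
end

section
/- Let X : Δ^op → Set be a simplicial set. Then X sends every pushout square in Δ whose span consists of injective maps to a weak pullback of sets if and only if, for every n ≥ 2 and all 0 ≤ i < j−1 ≤ n−1, X sends to a weak pullback the basic coface square with top d^i : [n−2] → [n−1], left d^{j−1} : [n−2] → [n−1], right d^j : [n−1] → [n], and bottom d^i : [n−1] → [n]. -/
open CategoryTheory CategoryTheory.Limits SimplexCategory

universe u

namespace SimplexCategory

open scoped Simplicial

/-- Any point missed by `f` and any point missed by `g` are strictly separated
by the images of a common point of the source. -/
def Separated {w x y : SimplexCategory} (f : w ⟶ x) (g : w ⟶ y) : Prop :=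
  ∀ a b, a ∉ Set.range f.toOrderHom → b ∉ Set.range g.toOrderHom →
    ∃ c, (a < f.toOrderHom c ∧ g.toOrderHom c < b) ∨ (f.toOrderHom c < a ∧ b < g.toOrderHom c)

/-- A commutative square in `Δ` whose right and bottom maps are injective and jointly
surjective. -/
structure IsJointCover {w x y z : SimplexCategory}
    (f : w ⟶ x) (g : w ⟶ y) (h : x ⟶ z) (k : y ⟶ z) : Prop where
  comm : f ≫ h = g ≫ k
  right_injective : Function.Injective h.toOrderHom
  bottom_injective : Function.Injective k.toOrderHom
  range_union : ∀ c, c ∈ Set.range h.toOrderHom ∨ c ∈ Set.range k.toOrderHom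

section

variable {w x y z : SimplexCategory} {f : w ⟶ x} {g : w ⟶ y} {h : x ⟶ z} {k : y ⟶ z}

lemma Separated.symm (H : Separated f g) : Separated g f := fun a b ha hb =>
  (H b a hb ha).imp fun _ => Or.symm ∘ Or.imp And.symm And.symm

lemma Separated.of_comp {x' y' : SimplexCategory} {f' : x ⟶ x'} {g' : y ⟶ y'}
    (H : Separated (f ≫ f') (g ≫ g')) (hf' : Function.Injective f'.toOrderHom)
    (hg' : Function.Injective g'.toOrderHom) : Separated f g := by
  intro a b ha hb
  have sf := f'.toOrderHom.monotone.strictMono_of_injective hf'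
  have sg := g'.toOrderHom.monotone.strictMono_of_injective hg'
  obtain ⟨c, hc⟩ := H (f'.toOrderHom a) (g'.toOrderHom b)
    (by rintro ⟨c, hc⟩; exact ha ⟨c, hf' hc⟩) (by rintro ⟨c, hc⟩; exact hb ⟨c, hg' hc⟩)
  exact ⟨c, hc.imp (And.imp sf.lt_iff_lt.1 sg.lt_iff_lt.1)
    (And.imp sf.lt_iff_lt.1 sg.lt_iff_lt.1)⟩

lemma IsJointCover.apply_comm (S : IsJointCover f g h k) (c : Fin (w.len + 1)) :
    h.toOrderHom (f.toOrderHom c) = k.toOrderHom (g.toOrderHom c) :=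
  congr_toOrderHom_apply S.comm c

lemma IsJointCover.symm (S : IsJointCover f g h k) : IsJointCover g f k h :=
  ⟨S.comm.symm, S.bottom_injective, S.right_injective, fun c => (S.range_union c).symm⟩

lemma IsJointCover.strictMono_right (S : IsJointCover f g h k) : StrictMono h.toOrderHom :=
  h.toOrderHom.monotone.strictMono_of_injective S.right_injective

lemma IsJointCover.paste {x' z' : SimplexCategory} {f' : x ⟶ x'} {h' : x' ⟶ z'} {k' : z ⟶ z'}
    (S : IsJointCover f g h k) (S' : IsJointCover f' h h' k') :
    IsJointCover (f ≫ f') g h' (k ≫ k') where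
  comm := by rw [Category.assoc, S'.comm, ← Category.assoc, S.comm, Category.assoc]
  right_injective := S'.right_injective
  bottom_injective := S'.bottom_injective.comp S.bottom_injective
  range_union c := by
    rcases S'.range_union c with hc | ⟨c, rfl⟩
    · exact .inl hc
    · rcases S.range_union c with ⟨c, rfl⟩ | ⟨c, rfl⟩
      · exact .inl ⟨_, S'.apply_comm c⟩
      · exact .inr ⟨c, rfl⟩

lemma isJointCover_id (hf : Function.Injective f.toOrderHom) :
    IsJointCover f (𝟙 w) (𝟙 x) f where
  comm := by simp
  right_injective := fun _ _ e => e
  bottom_injective := hf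
  range_union c := .inl ⟨c, rfl⟩

/-- Separation passes to the square pasted next to a jointly covering square. -/
lemma IsJointCover.separated {x' : SimplexCategory} {f' : x ⟶ x'}
    (S : IsJointCover f g h k) (H : Separated (f ≫ f') g) : Separated f' h := by
  intro a b ha hb
  obtain ⟨b, rfl⟩ := (S.range_union b).resolve_left hb
  obtain ⟨c, hc⟩ := H a b (by rintro ⟨c, rfl⟩; exact ha ⟨_, rfl⟩)
    (by rintro ⟨c, rfl⟩; exact hb ⟨_, S.apply_comm c⟩)
  refine ⟨f.toOrderHom c, ?_⟩
  rw [S.apply_comm]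
  exact hc.imp (And.imp_right fun e => S.symm.strictMono_right e)
    (And.imp_right fun e => S.symm.strictMono_right e)

lemma IsJointCover.le_of_le (S : IsJointCover f g h k) (H : Separated f g)
    {s : SimplexCategory} {φ : x ⟶ s} {ψ : y ⟶ s} (e : f ≫ φ = g ≫ ψ) {a b}
    (hab : h.toOrderHom a ≤ k.toOrderHom b) : φ.toOrderHom a ≤ ψ.toOrderHom b := by
  have e' (c) : φ.toOrderHom (f.toOrderHom c) = ψ.toOrderHom (g.toOrderHom c) :=
    congr_toOrderHom_apply e c
  by_cases ha : a ∈ Set.range f.toOrderHom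
  · obtain ⟨c, rfl⟩ := ha
    rw [S.apply_comm] at hab
    rw [e']
    exact ψ.toOrderHom.monotone (S.symm.strictMono_right.le_iff_le.1 hab)
  by_cases hb : b ∈ Set.range g.toOrderHom
  · obtain ⟨c, rfl⟩ := hb
    rw [← S.apply_comm] at hab
    rw [← e']
    exact φ.toOrderHom.monotone (S.strictMono_right.le_iff_le.1 hab)
  obtain ⟨c, ⟨h₁, h₂⟩ | ⟨h₁, h₂⟩⟩ := H a b ha hb
  · exact (φ.toOrderHom.monotone h₁.le).trans ((e' c).le.trans (ψ.toOrderHom.monotone h₂.le))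
  · have h₃ := S.strictMono_right h₁
    rw [S.apply_comm] at h₃
    exact absurd (hab.trans_lt (S.symm.strictMono_right h₂)) h₃.not_gt

lemma IsJointCover.exists_desc (S : IsJointCover f g h k) (H : Separated f g)
    {s : SimplexCategory} {φ : x ⟶ s} {ψ : y ⟶ s} (e : f ≫ φ = g ≫ ψ) :
    ∃ χ : z ⟶ s, h ≫ χ = φ ∧ k ≫ χ = ψ := by
  have key : ∀ c, ∃ d, (∀ a, h.toOrderHom a = c → φ.toOrderHom a = d) ∧
      ∀ b, k.toOrderHom b = c → ψ.toOrderHom b = d := by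
    intro c
    rcases S.range_union c with ⟨a, rfl⟩ | ⟨b, rfl⟩
    · exact ⟨φ.toOrderHom a, fun a' ha' => by rw [S.right_injective ha'],
        fun b hb => (S.symm.le_of_le H.symm e.symm hb.le).antisymm (S.le_of_le H e hb.ge)⟩
    · exact ⟨ψ.toOrderHom b, fun a ha =>
        (S.le_of_le H e ha.le).antisymm (S.symm.le_of_le H.symm e.symm ha.ge),
        fun b' hb' => by rw [S.bottom_injective hb']⟩
  choose d hφ hψ using key
  have mono : Monotone d := by
    intro c c' hcc
    rcases S.range_union c with ⟨a, rfl⟩ | ⟨b, rfl⟩ <;>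
      rcases S.range_union c' with ⟨a', rfl⟩ | ⟨b', rfl⟩
    · rw [← hφ _ a rfl, ← hφ _ a' rfl]
      exact φ.toOrderHom.monotone (S.strictMono_right.le_iff_le.1 hcc)
    · rw [← hφ _ a rfl, ← hψ _ b' rfl]
      exact S.le_of_le H e hcc
    · rw [← hψ _ b rfl, ← hφ _ a' rfl]
      exact S.symm.le_of_le H.symm e.symm hcc
    · rw [← hψ _ b rfl, ← hψ _ b' rfl]
      exact ψ.toOrderHom.monotone (S.symm.strictMono_right.le_iff_le.1 hcc)
  refine ⟨Hom.mk ⟨d, mono⟩, ?_, ?_⟩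
  · refine Hom.ext _ _ (OrderHom.ext _ _ (funext fun a => (hφ _ a rfl).symm))
  · refine Hom.ext _ _ (OrderHom.ext _ _ (funext fun b => (hψ _ b rfl).symm))

lemma IsJointCover.isPushout (S : IsJointCover f g h k) (H : Separated f g) :
    IsPushout f g h k where
  w := S.comm
  isColimit' := by
    choose d hd₁ hd₂ using fun s : PushoutCocone f g => S.exists_desc H s.condition
    refine ⟨PushoutCocone.IsColimit.mk S.comm d hd₁ hd₂ fun s m hm₁ hm₂ => ?_⟩
    refine Hom.ext _ _ (OrderHom.ext _ _ (funext fun c => ?_))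
    rcases S.range_union c with ⟨a, rfl⟩ | ⟨b, rfl⟩
    · exact congr_toOrderHom_apply (hm₁.trans (hd₁ s).symm) a
    · exact congr_toOrderHom_apply (hm₂.trans (hd₂ s).symm) b

end

section

variable {w x y z : SimplexCategory} {f : w ⟶ x} {g : w ⟶ y} {h : x ⟶ z} {k : y ⟶ z}

/-- The indicator function of an upper set, as a map to `⦋1⦌`. -/
noncomputable def indicator (x : SimplexCategory) (U : UpperSet (Fin (x.len + 1))) : x ⟶ ⦋1⦌ :=
  open Classical in
  Hom.mk ⟨fun a => if a ∈ U then 1 else 0, fun a b hab => by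
    by_cases ha : a ∈ U
    · have hb : b ∈ U := U.upper hab ha
      simp [ha, hb]
    · simp [ha]⟩

lemma indicator_apply_eq_one {U : UpperSet (Fin (x.len + 1))} {a : Fin (x.len + 1)} :
    (indicator x U).toOrderHom a = 1 ↔ a ∈ U := by
  classical
  change (if a ∈ U then (1 : Fin 2) else 0) = 1 ↔ _
  by_cases ha : a ∈ U <;> simp [ha]

lemma comp_indicator_eq {U : UpperSet (Fin (x.len + 1))} {V : UpperSet (Fin (y.len + 1))}
    (e : ∀ c, f.toOrderHom c ∈ U ↔ g.toOrderHom c ∈ V) :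
    f ≫ indicator x U = g ≫ indicator y V := by
  classical
  refine Hom.ext _ _ (OrderHom.ext _ _ (funext fun c => ?_))
  change (if f.toOrderHom c ∈ U then (1 : Fin 2) else 0) = if g.toOrderHom c ∈ V then 1 else 0
  simp only [e]

lemma exists_separating_of_le (P : IsPushout f g h k) {a b}
    (ha : a ∉ Set.range f.toOrderHom) (hab : h.toOrderHom a ≤ k.toOrderHom b) :
    ∃ c, (a < f.toOrderHom c ∧ g.toOrderHom c ≤ b) ∨
      (f.toOrderHom c < a ∧ b < g.toOrderHom c) := by
  by_contra! H
  have e : f ≫ indicator x (UpperSet.Ici a) = g ≫ indicator y (UpperSet.Ioi b) := by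
    refine comp_indicator_eq fun c => ?_
    rw [UpperSet.mem_Ici_iff, UpperSet.mem_Ioi_iff]
    constructor
    · intro hc
      exact (H c).1 (lt_of_le_of_ne hc fun h => ha ⟨c, h.symm⟩)
    · intro hc
      by_contra hc'
      exact absurd ((H c).2 (not_le.1 hc')) (not_le.2 hc)
  have h₁ : (P.desc _ _ e).toOrderHom (h.toOrderHom a) = 1 :=
    (congr_toOrderHom_apply (P.inl_desc _ _ e) a).trans
      (indicator_apply_eq_one.2 (UpperSet.mem_Ici_iff.2 le_rfl))
  have h₂ : (P.desc _ _ e).toOrderHom (k.toOrderHom b) = 1 := by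
    refine le_antisymm (Fin.le_last _) ?_
    rw [← h₁]
    exact (P.desc _ _ e).toOrderHom.monotone hab
  have h₃ := indicator_apply_eq_one.1 ((congr_toOrderHom_apply (P.inr_desc _ _ e) b).symm.trans h₂)
  exact lt_irrefl _ (UpperSet.mem_Ioi_iff.1 h₃)

lemma separated_of_isPushout (P : IsPushout f g h k) : Separated f g := by
  intro a b ha hb
  rcases le_total (h.toOrderHom a) (k.toOrderHom b) with hab | hab
  · obtain ⟨c, hc⟩ := exists_separating_of_le P ha hab
    exact ⟨c, hc.imp_left (And.imp_right fun e => lt_of_le_of_ne e fun e' => hb ⟨c, e'⟩)⟩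
  · obtain ⟨c, hc⟩ := exists_separating_of_le P.flip hb hab
    refine ⟨c, hc.symm.imp And.symm ?_⟩
    exact fun ⟨h₁, h₂⟩ => ⟨lt_of_le_of_ne h₂ fun e' => ha ⟨c, e'⟩, h₁⟩

end

lemma δ_toOrderHom_apply {n : ℕ} (i : Fin (n + 2)) (a : Fin (n + 1)) :
    (δ i).toOrderHom a = i.succAbove a := rfl

lemma δ_toOrderHom_injective {n : ℕ} (i : Fin (n + 2)) : Function.Injective (δ i).toOrderHom :=
  Fin.succAbove_right_injective

lemma mem_range_δ {n : ℕ} (i a : Fin (n + 2)) :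
    a ∈ Set.range (δ i).toOrderHom ↔ a ≠ i := by
  rw [show Set.range (δ i).toOrderHom = {i}ᶜ from Fin.range_succAbove i]
  rfl

lemma isJointCover_δ {n : ℕ} {i j : Fin (n + 2)} (hij : i < j) :
    IsJointCover (δ i) (δ j) (δ j.succ) (δ i.castSucc) where
  comm := δ_comp_δ hij.le
  right_injective := δ_toOrderHom_injective _
  bottom_injective := δ_toOrderHom_injective _
  range_union c := by
    rw [mem_range_δ, mem_range_δ]
    by_contra! H
    have := H.1.symm.trans H.2
    simp only [Fin.ext_iff, Fin.val_succ, Fin.val_castSucc, Fin.lt_def] at this hij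
    omega

lemma separated_δ {n : ℕ} {i j : Fin (n + 2)} (hij : i < j) :
    Separated (δ i : ⦋n⦌ ⟶ ⦋n + 1⦌) (δ j : ⦋n⦌ ⟶ ⦋n + 1⦌) := by
  intro a b ha hb
  rw [mem_range_δ, not_not] at ha hb
  subst ha hb
  refine ⟨a.castPred (Fin.ne_last_of_lt hij), .inl ?_⟩
  rw [δ_toOrderHom_apply, δ_toOrderHom_apply, Fin.lt_succAbove_iff_le_castSucc,
    Fin.succAbove_lt_iff_castSucc_lt]
  exact ⟨le_rfl, hij⟩

lemma Separated.ne {n : ℕ} {i j : Fin (n + 2)}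
    (H : Separated (δ i : ⦋n⦌ ⟶ ⦋n + 1⦌) (δ j : ⦋n⦌ ⟶ ⦋n + 1⦌)) : i ≠ j := by
  rintro rfl
  obtain ⟨c, hc | hc⟩ := H i i (by rw [mem_range_δ, not_not]) (by rw [mem_range_δ, not_not])
  · exact lt_asymm hc.1 hc.2
  · exact lt_asymm hc.1 hc.2

lemma exists_eq_δ_comp {m : ℕ} {y : SimplexCategory} (g : ⦋m⦌ ⟶ y)
    (hg : Function.Injective g.toOrderHom) (hlt : m < y.len) :
    ∃ (i : Fin (m + 2)) (g' : ⦋m + 1⦌ ⟶ y), g = δ i ≫ g' ∧ Function.Injective g'.toOrderHom := by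
  obtain ⟨q⟩ := y
  induction q with
  | zero => exact absurd hlt (Nat.not_lt_zero _)
  | succ q ih =>
    obtain ⟨i, g₁, rfl⟩ := eq_comp_δ_of_not_surjective g fun hs => by
      have := Fintype.card_le_of_surjective _ hs
      simp at this hlt
      omega
    have hg₁ : Function.Injective g₁.toOrderHom :=
      Function.Injective.of_comp (f := (δ i).toOrderHom) hg
    rcases (Nat.lt_succ_iff.1 hlt).eq_or_lt with rfl | hlt'
    · have := mono_iff_injective.2 hg₁
      exact ⟨i, 𝟙 _, by rw [eq_id_of_mono g₁]; simp, fun _ _ e => e⟩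
    · obtain ⟨j, g₂, rfl, hg₂⟩ := ih g₁ hg₁ hlt'
      exact ⟨j, g₂ ≫ δ i, by simp, (δ_toOrderHom_injective i).comp hg₂⟩

end SimplexCategory

section

variable {X : SimplexCategoryᵒᵖ ⥤ Type u} {w x y z : SimplexCategory}
  {f : w ⟶ x} {g : w ⟶ y} {h : x ⟶ z} {k : y ⟶ z}

lemma SendsToWeakPullback.symm (W : SendsToWeakPullback X f g h k) :
    SendsToWeakPullback X g f k h := fun b c e =>
  (W c b e.symm).imp fun _ => And.symm

lemma SendsToWeakPullback.paste {x' z' : SimplexCategory} {f' : x ⟶ x'} {h' : x' ⟶ z'}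
    {k' : z ⟶ z'} (W : SendsToWeakPullback X f g h k) (W' : SendsToWeakPullback X f' h h' k') :
    SendsToWeakPullback X (f ≫ f') g h' (k ≫ k') := by
  intro b c e
  obtain ⟨a, ha₁, ha₂⟩ := W (X.map f'.op b) c (by rw [← e]; simp)
  obtain ⟨d, hd₁, hd₂⟩ := W' b a ha₁.symm
  exact ⟨d, hd₁, by rw [← ha₂, ← hd₂]; simp⟩

lemma sendsToWeakPullback_id : SendsToWeakPullback X f (𝟙 w) (𝟙 x) f := fun b c e =>
  ⟨b, by simp, by simpa using e⟩

lemma SendsToWeakPullback.of_comp {z' : SimplexCategory} {h' : x ⟶ z'} {k' : y ⟶ z'}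
    (W : SendsToWeakPullback X f g h k) (t : z' ⟶ z) (ht : h' ≫ t = h) (kt : k' ≫ t = k) :
    SendsToWeakPullback X f g h' k' := by
  intro b c e
  obtain ⟨a, rfl, rfl⟩ := W b c e
  exact ⟨X.map t.op a, by simp [← ht], by simp [← kt]⟩

/-- `f` and `g` extend to a jointly covering square that `X` sends to a weak pullback. -/
def HasWeakPullbackCover (X : SimplexCategoryᵒᵖ ⥤ Type u) (f : w ⟶ x) (g : w ⟶ y) : Prop :=
  ∃ (z : SimplexCategory) (h : x ⟶ z) (k : y ⟶ z),
    IsJointCover f g h k ∧ SendsToWeakPullback X f g h k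

lemma HasWeakPullbackCover.symm (C : HasWeakPullbackCover X f g) :
    HasWeakPullbackCover X g f := by
  obtain ⟨z, h, k, S, W⟩ := C
  exact ⟨z, k, h, S.symm, W.symm⟩

lemma hasWeakPullbackCover_id (hf : Function.Injective f.toOrderHom) :
    HasWeakPullbackCover X f (𝟙 w) :=
  ⟨x, 𝟙 x, f, isJointCover_id hf, sendsToWeakPullback_id⟩

end

section

open scoped Simplicial

variable {X : SimplexCategoryᵒᵖ ⥤ Type u}

lemma HasWeakPullbackCover.paste {w x x' y z : SimplexCategory} {f : w ⟶ x} {g : w ⟶ y}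
    {h : x ⟶ z} {k : y ⟶ z} {f' : x ⟶ x'} (S : IsJointCover f g h k)
    (W : SendsToWeakPullback X f g h k) (C : HasWeakPullbackCover X f' h) :
    HasWeakPullbackCover X (f ≫ f') g := by
  obtain ⟨z', h', k', S', W'⟩ := C
  exact ⟨z', h', k ≫ k', S.paste S', W.paste W'⟩

lemma hasWeakPullbackCover_δ
    (H : ∀ (r : ℕ) (i j' : Fin (r + 2)), i < j' →
      SendsToWeakPullback X (δ i) (δ j') (δ j'.succ) (δ i.castSucc))
    {m : ℕ} {x : SimplexCategory} (f : ⦋m⦌ ⟶ x) (j : Fin (m + 2))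
    (hf : Function.Injective f.toOrderHom) (hfj : Separated f (δ j)) :
    HasWeakPullbackCover X f (δ j) := by
  induction hd : x.len - m generalizing m with
  | zero =>
    have := mono_iff_injective.2 hf
    obtain rfl : x = ⦋m⦌ := SimplexCategory.ext (by
      have : m ≤ x.len := len_le_of_mono f
      change x.len = m
      omega)
    rw [eq_id_of_mono f]
    exact (hasWeakPullbackCover_id (δ_toOrderHom_injective j)).symm
  | succ d ih =>
    obtain ⟨i, f', rfl, hf'⟩ := exists_eq_δ_comp f hf (by omega)
    have hij : i ≠ j := Separated.ne (Separated.of_comp (g' := 𝟙 _)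
      (by rwa [Category.comp_id]) hf' fun _ _ e => e)
    rcases hij.lt_or_gt with hij | hij
    · have S := isJointCover_δ hij
      exact .paste S (H _ _ _ hij) (ih f' _ hf' (S.separated hfj) (by omega))
    · have S := (isJointCover_δ hij).symm
      exact .paste S (H _ _ _ hij).symm (ih f' _ hf' (S.separated hfj) (by omega))

lemma hasWeakPullbackCover_of_separated
    (H : ∀ (r : ℕ) (i j' : Fin (r + 2)), i < j' →
      SendsToWeakPullback X (δ i) (δ j') (δ j'.succ) (δ i.castSucc))
    {w x y : SimplexCategory} (f : w ⟶ x) (g : w ⟶ y)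
    (hf : Function.Injective f.toOrderHom) (hg : Function.Injective g.toOrderHom)
    (hfg : Separated f g) : HasWeakPullbackCover X f g := by
  obtain ⟨m⟩ := w
  induction hd : x.len - m generalizing m y with
  | zero =>
    have := mono_iff_injective.2 hf
    obtain rfl : x = ⦋m⦌ := SimplexCategory.ext (by
      have : m ≤ x.len := len_le_of_mono f
      change x.len = m
      omega)
    rw [eq_id_of_mono f]
    exact (hasWeakPullbackCover_id hg).symm
  | succ d ih =>
    obtain ⟨i, f', rfl, hf'⟩ := exists_eq_δ_comp f hf (by omega)
    obtain ⟨z, h, k, S, W⟩ := (hasWeakPullbackCover_δ H g i hg (Separated.of_comp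
      (g' := f') (f' := 𝟙 _) (by rw [Category.comp_id]; exact hfg.symm) (fun _ _ e => e) hf')).symm
    exact .paste S W (ih _ f' h hf' S.right_injective (S.separated hfg) (by omega))

end

/-- A simplicial set sends every pushout square in `Δ` whose span consists
of injective maps to a weak pullback of sets if and only if it sends every basic coface square
(top `d^i : [n-2] → [n-1]`, left `d^{j-1} : [n-2] → [n-1]`, right `d^j : [n-1] → [n]`, bottom
`d^i : [n-1] → [n]`, for `0 ≤ i < j - 1 ≤ n - 1`) to a weak pullback. Here, for `n - 2 = r`,
`j - 1` is represented by `j' : Fin (r + 2)` with `i < j'`. -/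
theorem innerSpanComplete_iff_basicCofaceSquares (X : SimplexCategoryᵒᵖ ⥤ Type u) :
    (∀ {w x y z : SimplexCategory} (f : w ⟶ x) (g : w ⟶ y) (h : x ⟶ z) (k : y ⟶ z),
        IsPushout f g h k → Function.Injective f.toOrderHom →
        Function.Injective g.toOrderHom → SendsToWeakPullback X f g h k) ↔
      (∀ (r : ℕ) (i j' : Fin (r + 2)), i < j' →
        SendsToWeakPullback X (δ i) (δ j') (δ j'.succ) (δ i.castSucc)) := by
  constructor
  · intro H r i j' hij
    exact H _ _ _ _ ((isJointCover_δ hij).isPushout (separated_δ hij)) (δ_toOrderHom_injective _)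
      (δ_toOrderHom_injective _)
  · intro H w x y z f g h k P hf hg
    obtain ⟨z', h', k', S, W⟩ :=
      hasWeakPullbackCover_of_separated H f g hf hg (separated_of_isPushout P)
    exact W.of_comp (P.desc h' k' S.comm) (P.inl_desc _ _ _) (P.inr_desc _ _ _)
end

section
/- Let n ≥ 0 and let S be a directed simplicial complex on {0,…,n}: a collection of nonempty subsets of {0,…,n}, closed under passing to nonempty subsets, whose union is {0,…,n}. Then S is directed Graham acyclic if and only if S has the directed running intersection property. -/
/-- `A` is a maximal simplex (maximal member) of `S`. -/
def IsMaxFace (S : Finset (Finset ℕ)) (A : Finset ℕ) : Prop :=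
  A ∈ S ∧ ∀ B ∈ S, A ⊆ B → A = B

/-- The reduction `S ∖ {v} = {A ∖ {v} : A ∈ S, A ≠ {v}}`. -/
def reduceAt (S : Finset (Finset ℕ)) (v : ℕ) : Finset (Finset ℕ) :=
  (S.filter (· ≠ {v})).image (fun A => A.erase v)

/-- A vertex `v` is extremal in `S` if it belongs to exactly one maximal simplex of `S`. -/
def Extremal (S : Finset (Finset ℕ)) (v : ℕ) : Prop :=
  ∃! A : Finset ℕ, IsMaxFace S A ∧ v ∈ A

/-- Directed Graham acyclicity of a directed simplicial complex `S` on the ground set `V`: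
either `|V| = 1`, or there is an extremal vertex `v` such that the edge from the predecessor
of `v` in `V` to `v` (if it exists) is in `S`, the edge from `v` to the successor of `v` in
`V` (if it exists) is in `S`, and `S ∖ {v}` is again directed Graham acyclic on `V ∖ {v}`. -/
inductive DirGrahamAcyclic : Finset ℕ → Finset (Finset ℕ) → Prop
  | base (V : Finset ℕ) (S : Finset (Finset ℕ)) (h : V.card = 1) : DirGrahamAcyclic V S
  | step (V : Finset ℕ) (S : Finset (Finset ℕ)) (v : ℕ) (hv : v ∈ V)
      (hext : Extremal S v)
      (hpred : ∀ u ∈ V, u < v → (∀ w ∈ V, w < v → w ≤ u) → ({u, v} : Finset ℕ) ∈ S)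
      (hsucc : ∀ w ∈ V, v < w → (∀ u ∈ V, v < u → w ≤ u) → ({v, w} : Finset ℕ) ∈ S)
      (hrec : DirGrahamAcyclic (V.erase v) (reduceAt S v)) :
      DirGrahamAcyclic V S

/-- The union of a list of finite sets. -/
def listUnion (L : List (Finset ℕ)) : Finset ℕ := L.foldr (· ∪ ·) ∅

/-- The directed running intersection property: the maximal simplices of `S` can be ordered as
`T₁, …, T_m` so that each `T_k` meets the union of its predecessors inside a single earlier
`T_j`, and every pair of consecutive vertices of `T₁ ∪ ⋯ ∪ T_k` forms an edge contained in
`T_k` or in `T₁ ∪ ⋯ ∪ T_{k−1}`. (Lists here are 0-indexed: `L.get ⟨k, _⟩` is `T_{k+1}`.) -/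
def DirectedRIP (S : Finset (Finset ℕ)) : Prop :=
  ∃ L : List (Finset ℕ), L.Nodup ∧ (∀ A : Finset ℕ, A ∈ L ↔ IsMaxFace S A) ∧
    (∀ k : ℕ, (hk0 : 0 < k) → (hk : k < L.length) →
      ∃ j : ℕ, ∃ hj : j < k,
        listUnion (L.take k) ∩ L.get ⟨k, hk⟩ ⊆ L.get ⟨j, by omega⟩) ∧
    (∀ k : ℕ, (hk : k < L.length) → ∀ v w : ℕ,
      v ∈ listUnion (L.take (k + 1)) → w ∈ listUnion (L.take (k + 1)) → v < w →
      (∀ z ∈ listUnion (L.take (k + 1)), ¬(v < z ∧ z < w)) →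
      (({v, w} : Finset ℕ) ⊆ L.get ⟨k, hk⟩ ∨ ({v, w} : Finset ℕ) ⊆ listUnion (L.take k)))

/-- `S` is a directed simplicial complex on the ground set `V`. -/
structure IsComplexOn (V : Finset ℕ) (S : Finset (Finset ℕ)) : Prop where
  nonempty : ∀ A ∈ S, A.Nonempty
  subset : ∀ A ∈ S, A ⊆ V
  down : ∀ A ∈ S, ∀ B : Finset ℕ, B ⊆ A → B.Nonempty → B ∈ S
  cover : ∀ v ∈ V, ∃ A ∈ S, v ∈ A

/-- The conditions that the directed running intersection property imposes on a set `T` following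
the sets listed in `L`. -/
def ExtendsChain (L : List (Finset ℕ)) (T : Finset ℕ) : Prop :=
  (L ≠ [] → ∃ A ∈ L, listUnion L ∩ T ⊆ A) ∧
    ∀ x y, x ∈ T ∪ listUnion L → y ∈ T ∪ listUnion L → x < y →
      (∀ z ∈ T ∪ listUnion L, ¬(x < z ∧ z < y)) →
      (x ∈ T ∧ y ∈ T) ∨ (x ∈ listUnion L ∧ y ∈ listUnion L)

/-- A list, in reverse order, satisfying the conditions of the directed running intersection
property. -/
def IsRIPChain : List (Finset ℕ) → Prop
  | [] => True
  | T :: L => ExtendsChain L T ∧ IsRIPChain L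

theorem mem_listUnion {L : List (Finset ℕ)} {x : ℕ} : x ∈ listUnion L ↔ ∃ A ∈ L, x ∈ A := by
  induction L with
  | nil => simp [listUnion]
  | cons T L ih =>
    have : listUnion (T :: L) = T ∪ listUnion L := rfl
    simp [this, ih]

theorem listUnion_reverse (L : List (Finset ℕ)) : listUnion L.reverse = listUnion L := by
  ext x; simp [mem_listUnion]

theorem isRIPChain_reverse_iff (L : List (Finset ℕ)) :
    IsRIPChain L.reverse ↔
      ∀ k (hk : k < L.length), ExtendsChain (L.take k) (L[k]) := by
  induction L using List.reverseRecOn with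
  | nil => simp [IsRIPChain]
  | append_singleton L T ih =>
    have hrev : ExtendsChain L.reverse T ↔ ExtendsChain L T := by
      simp [ExtendsChain, listUnion_reverse]
    simp only [List.reverse_append, List.reverse_singleton, List.singleton_append, IsRIPChain, hrev,
      ih]
    constructor
    · rintro ⟨hT, hL⟩ k hk
      rcases Nat.lt_or_ge k L.length with h | h
      · rw [List.take_append_of_le_length h.le, List.getElem_append_left h]
        exact hL k h
      · obtain rfl : k = L.length := by simp at hk; omega
        simpa using hT
    · intro h
      refine ⟨by simpa using h L.length (by simp), fun k hk => ?_⟩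
      have := h k (by simp; omega)
      rwa [List.take_append_of_le_length hk.le, List.getElem_append_left hk] at this

theorem extendsChain_take_iff (L : List (Finset ℕ)) (k : ℕ) (hk : k < L.length) :
    ExtendsChain (L.take k) (L[k]) ↔
      (0 < k → ∃ j : ℕ, ∃ hj : j < k,
        listUnion (L.take k) ∩ L.get ⟨k, hk⟩ ⊆ L.get ⟨j, by omega⟩) ∧
      (∀ v w : ℕ,
        v ∈ listUnion (L.take (k + 1)) → w ∈ listUnion (L.take (k + 1)) → v < w →
        (∀ z ∈ listUnion (L.take (k + 1)), ¬(v < z ∧ z < w)) →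
        (({v, w} : Finset ℕ) ⊆ L.get ⟨k, hk⟩ ∨ ({v, w} : Finset ℕ) ⊆ listUnion (L.take k))) := by
  have hU : listUnion (L.take (k + 1)) = L[k] ∪ listUnion (L.take k) := by
    ext x
    rw [← List.take_concat_get' L k hk]
    simp only [Finset.mem_union, mem_listUnion, List.mem_append, List.mem_singleton]
    grind
  rw [hU]
  simp only [ExtendsChain, List.get_eq_getElem, Finset.insert_subset_iff,
    Finset.singleton_subset_iff]
  refine and_congr ?_ Iff.rfl
  have hnil : L.take k ≠ [] ↔ 0 < k := by
    rw [← List.length_pos_iff]; simp; omega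
  rw [hnil]
  refine imp_congr_right fun _ => ?_
  constructor
  · rintro ⟨A, hA, h⟩
    obtain ⟨j, hj, rfl⟩ := List.mem_iff_getElem.1 hA
    have hj' : j < k := by simp at hj; omega
    exact ⟨j, hj', by simpa using h⟩
  · rintro ⟨j, hj, h⟩
    exact ⟨_, List.mem_take_iff_getElem.2 ⟨j, by omega, rfl⟩, h⟩

theorem directedRIP_iff (S : Finset (Finset ℕ)) :
    DirectedRIP S ↔
      ∃ L : List (Finset ℕ), L.Nodup ∧ (∀ A, A ∈ L ↔ IsMaxFace S A) ∧ IsRIPChain L := by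
  have key : ∀ L : List (Finset ℕ), IsRIPChain L.reverse ↔ _ := fun L =>
    (isRIPChain_reverse_iff L).trans (forall₂_congr (extendsChain_take_iff L))
  constructor
  · rintro ⟨L, hnd, hmem, h₁, h₂⟩
    exact ⟨L.reverse, by simpa using hnd, by simpa using hmem,
      (key L).2 fun k hk => ⟨fun h0 => h₁ k h0 hk, h₂ k hk⟩⟩
  · rintro ⟨L, hnd, hmem, h⟩
    have h' := (key L.reverse).1 (by simpa using h)
    exact ⟨L.reverse, by simpa using hnd, by simpa using hmem,
      fun k h0 hk => (h' k hk).1 h0, fun k hk => (h' k hk).2⟩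

namespace IsComplexOn

variable {V : Finset ℕ} {S : Finset (Finset ℕ)} {v : ℕ}

theorem mem_reduceAt (h : IsComplexOn V S) {B : Finset ℕ} :
    B ∈ reduceAt S v ↔ B ∈ S ∧ v ∉ B := by
  simp only [reduceAt, Finset.mem_image, Finset.mem_filter]
  constructor
  · rintro ⟨A, ⟨hA, hAv⟩, rfl⟩
    refine ⟨h.down A hA _ (Finset.erase_subset _ _) ?_, by simp⟩
    rw [Finset.nonempty_iff_ne_empty]
    intro he
    rcases Finset.erase_eq_empty_iff A v |>.1 he with h0 | h0
    · exact (h.nonempty A hA).ne_empty h0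
    · exact hAv h0
  · rintro ⟨hB, hv⟩
    exact ⟨B, ⟨hB, by rintro rfl; simp at hv⟩, Finset.erase_eq_of_notMem hv⟩

theorem reduce (h : IsComplexOn V S) (v : ℕ) : IsComplexOn (V.erase v) (reduceAt S v) where
  nonempty A hA := h.nonempty A (h.mem_reduceAt.1 hA).1
  subset A hA := Finset.subset_erase.2
    ⟨h.subset A (h.mem_reduceAt.1 hA).1, (h.mem_reduceAt.1 hA).2⟩
  down A hA B hBA hB :=
    h.mem_reduceAt.2 ⟨h.down A (h.mem_reduceAt.1 hA).1 B hBA hB,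
      fun hv => (h.mem_reduceAt.1 hA).2 (hBA hv)⟩
  cover u hu := by
    obtain ⟨huv, huV⟩ := Finset.mem_erase.1 hu
    obtain ⟨A, hA, huA⟩ := h.cover u huV
    have hu' : u ∈ A.erase v := Finset.mem_erase.2 ⟨huv, huA⟩
    exact ⟨A.erase v, h.mem_reduceAt.2
      ⟨h.down A hA _ (Finset.erase_subset _ _) ⟨u, hu'⟩, by simp⟩, hu'⟩

end IsComplexOn

theorem exists_isMaxFace_superset {S : Finset (Finset ℕ)} {A : Finset ℕ} (hA : A ∈ S) :
    ∃ B, IsMaxFace S B ∧ A ⊆ B := by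
  obtain ⟨B, hAB, hB⟩ := S.exists_le_maximal hA
  exact ⟨B, ⟨hB.1, fun C hC hBC => Finset.Subset.antisymm hBC (hB.2 hC hBC)⟩, hAB⟩

namespace IsComplexOn

variable {V : Finset ℕ} {S : Finset (Finset ℕ)} {v : ℕ} {F : Finset ℕ}

theorem isMaxFace_reduceAt_iff (h : IsComplexOn V S) (hF : IsMaxFace S F) (hvF : v ∈ F)
    (huniq : ∀ A, IsMaxFace S A → v ∈ A → A = F) {A : Finset ℕ} :
    IsMaxFace (reduceAt S v) A ↔
      (IsMaxFace S A ∧ A ≠ F) ∨ (A = F.erase v ∧ IsMaxFace (reduceAt S v) (F.erase v)) := by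
  constructor
  · intro hA
    obtain ⟨hAS, hvA⟩ := h.mem_reduceAt.1 hA.1
    obtain ⟨C, hC, hAC⟩ := exists_isMaxFace_superset hAS
    by_cases hvC : v ∈ C
    · obtain rfl := huniq C hC hvC
      have hsub : A ⊆ C.erase v := Finset.subset_erase.2 ⟨hAC, hvA⟩
      have hmem : C.erase v ∈ reduceAt S v := h.mem_reduceAt.2
        ⟨h.down C hC.1 _ (Finset.erase_subset _ _) ((h.nonempty A hAS).mono hsub), by simp⟩
      have := hA.2 _ hmem hsub
      exact Or.inr ⟨this, this ▸ hA⟩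
    · obtain rfl := hA.2 C (h.mem_reduceAt.2 ⟨hC.1, hvC⟩) hAC
      exact Or.inl ⟨hC, by rintro rfl; exact hvC hvF⟩
  · rintro (⟨hA, hne⟩ | ⟨rfl, hA⟩)
    · exact ⟨h.mem_reduceAt.2 ⟨hA.1, fun hv => hne (huniq A hA hv)⟩,
        fun B hB hAB => hA.2 B (h.mem_reduceAt.1 hB).1 hAB⟩
    · exact hA

theorem mem_ground_iff (h : IsComplexOn V S) {L : List (Finset ℕ)}
    (hL : ∀ A, A ∈ L ↔ IsMaxFace S A) {x : ℕ} : x ∈ listUnion L ↔ x ∈ V := by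
  rw [mem_listUnion]
  constructor
  · rintro ⟨A, hA, hx⟩
    exact h.subset A ((hL A).1 hA).1 hx
  · intro hx
    obtain ⟨A, hA, hxA⟩ := h.cover x hx
    obtain ⟨B, hB, hAB⟩ := exists_isMaxFace_superset hA
    exact ⟨B, (hL B).2 hB, hAB hxA⟩

end IsComplexOn

/-- Adding a new vertex `v` to one member of a chain, provided that this member contains closest
neighbours of `v`, gives a chain. -/
theorem IsRIPChain.map_insert {L : List (Finset ℕ)} {F : Finset ℕ} {v : ℕ} (hvF : v ∈ F)
    (hnd : L.Nodup) (hv : v ∉ listUnion L)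
    (hpred : ∀ u ∈ listUnion L, u < v → ∃ u₀ ∈ F, u ≤ u₀ ∧ u₀ < v)
    (hsucc : ∀ w ∈ listUnion L, v < w → ∃ w₀ ∈ F, w₀ ≤ w ∧ v < w₀)
    (h : IsRIPChain L) :
    IsRIPChain (L.map fun A => if A = F.erase v then F else A) := by
  induction L with
  | nil => trivial
  | cons T L ih =>
    obtain ⟨⟨hint, hcons⟩, hL⟩ := h
    have hU : ∀ x, x ∈ listUnion (T :: L) ↔ x ∈ T ∨ x ∈ listUnion L := by
      intro x; simp [mem_listUnion]
    simp only [hU] at hv hpred hsucc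
    push Not at hv
    obtain ⟨hTL, hnd⟩ := List.nodup_cons.1 hnd
    refine ⟨?_, ih hnd hv.2 (fun u hu => hpred u (.inr hu)) (fun u hu => hsucc u (.inr hu)) hL⟩
    have hmap : ∀ x, x ∈ listUnion (L.map fun A => if A = F.erase v then F else A) ↔
        x ∈ listUnion L ∨ (x = v ∧ F.erase v ∈ L) := by
      intro x
      simp only [mem_listUnion, List.mem_map]
      constructor
      · rintro ⟨_, ⟨A, hA, rfl⟩, hx⟩
        grind
      · rintro (⟨A, hA, hx⟩ | ⟨rfl, hF⟩)
        · exact ⟨_, ⟨A, hA, rfl⟩, by grind⟩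
        · exact ⟨_, ⟨_, hF, rfl⟩, by grind⟩
    have hFL : F.erase v ∈ L → ∀ x ∈ F, x ≠ v → x ∈ listUnion L := fun hF x hx hxv =>
      mem_listUnion.2 ⟨_, hF, Finset.mem_erase.2 ⟨hxv, hx⟩⟩
    refine ⟨fun hne => ?_, fun x y hx hy hxy hz => ?_⟩
    · obtain ⟨A, hA, hAs⟩ := hint (by simpa using hne)
      refine ⟨_, List.mem_map.2 ⟨A, hA, rfl⟩, fun x hx => ?_⟩
      simp only [Finset.mem_inter, hmap] at hx
      have := @hAs x
      simp only [Finset.mem_inter] at this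
      grind
    · simp only [Finset.mem_union, hmap] at hx hy hz ⊢
      have hc := hcons x y
      simp only [Finset.mem_union] at hc
      by_cases hT : T = F.erase v
      · subst hT
        simp only [if_true, hTL, and_false, or_false] at hx hy hz ⊢
        grind
      · simp only [if_neg hT] at hx hy hz ⊢
        by_cases hF : F.erase v ∈ L
        · have := hFL hF
          grind
        · simp only [hF, and_false, or_false] at hx hy hz ⊢
          exact hc hx hy hxy hz

namespace IsComplexOn

variable {V : Finset ℕ} {S : Finset (Finset ℕ)} {v : ℕ}

theorem directedRIP_of_reduceAt (h : IsComplexOn V S) (hext : Extremal S v)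
    (hpred : ∀ u ∈ V, u < v → (∀ w ∈ V, w < v → w ≤ u) → ({u, v} : Finset ℕ) ∈ S)
    (hsucc : ∀ w ∈ V, v < w → (∀ u ∈ V, v < u → w ≤ u) → ({v, w} : Finset ℕ) ∈ S)
    (hrec : DirectedRIP (reduceAt S v)) : DirectedRIP S := by
  obtain ⟨L, hnd, hmem, hchain⟩ := (directedRIP_iff _).1 hrec
  obtain ⟨F, ⟨hF, hvF⟩, huniq⟩ := hext
  replace huniq : ∀ A, IsMaxFace S A → v ∈ A → A = F := fun A hA hvA => huniq A ⟨hA, hvA⟩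
  have hiff := fun A => (hmem A).trans (h.isMaxFace_reduceAt_iff hF hvF huniq)
  have hground : ∀ x, x ∈ listUnion L ↔ x ∈ V.erase v := fun x =>
    (h.reduce v).mem_ground_iff hmem
  have hedge : ∀ E ∈ S, v ∈ E → E ⊆ F := by
    intro E hE hvE
    obtain ⟨C, hC, hEC⟩ := exists_isMaxFace_superset hE
    exact huniq C hC (hEC hvE) ▸ hEC
  have hp : ∀ u ∈ listUnion L, u < v → ∃ u₀ ∈ F, u ≤ u₀ ∧ u₀ < v := by
    intro u hu huv
    have hu' : u ∈ V.filter (· < v) :=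
      Finset.mem_filter.2 ⟨Finset.mem_of_mem_erase ((hground u).1 hu), huv⟩
    obtain ⟨u₀, hu₀, hmax⟩ := (V.filter (· < v)).exists_max_image id ⟨u, hu'⟩
    obtain ⟨hu₀V, hu₀v⟩ := Finset.mem_filter.1 hu₀
    exact ⟨u₀, hedge _ (hpred u₀ hu₀V hu₀v fun w hw hwv =>
      hmax w (Finset.mem_filter.2 ⟨hw, hwv⟩)) (by simp) (by simp), hmax u hu', hu₀v⟩
  have hs : ∀ w ∈ listUnion L, v < w → ∃ w₀ ∈ F, w₀ ≤ w ∧ v < w₀ := by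
    intro w hw hvw
    have hw' : w ∈ V.filter (v < ·) :=
      Finset.mem_filter.2 ⟨Finset.mem_of_mem_erase ((hground w).1 hw), hvw⟩
    obtain ⟨w₀, hw₀, hmin⟩ := (V.filter (v < ·)).exists_min_image id ⟨w, hw'⟩
    obtain ⟨hw₀V, hvw₀⟩ := Finset.mem_filter.1 hw₀
    exact ⟨w₀, hedge _ (hsucc w₀ hw₀V hvw₀ fun u hu hvu =>
      hmin u (Finset.mem_filter.2 ⟨hu, hvu⟩)) (by simp) (by simp), hmin w hw', hvw₀⟩
  have hvL : v ∉ listUnion L := by simp [hground]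
  have hvA : ∀ A ∈ L, v ∉ A := fun A hA hv => hvL (mem_listUnion.2 ⟨A, hA, hv⟩)
  rw [directedRIP_iff]
  by_cases hFv : IsMaxFace (reduceAt S v) (F.erase v)
  · refine ⟨_, ?_, fun A => ?_, hchain.map_insert hvF hnd hvL hp hs⟩
    · refine hnd.map_on fun A hA B hB hAB => ?_
      have := hvA A hA
      have := hvA B hB
      grind
    · have hFL : F.erase v ∈ L := (hmem _).2 hFv
      have hFe : ¬ IsMaxFace S (F.erase v) := fun hm => by
        have := hm.2 F hF.1 (Finset.erase_subset _ _)
        exact Finset.erase_eq_self.1 this hvF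
      rw [List.mem_map]
      constructor
      · rintro ⟨B, hB, rfl⟩
        have := hiff B
        grind
      · intro hA
        by_cases hAF : A = F
        · exact ⟨_, hFL, by simp [hAF]⟩
        · exact ⟨A, (hiff A).2 (.inl ⟨hA, hAF⟩), if_neg (by rintro rfl; exact hFe hA)⟩
  · simp only [hFv, and_false, or_false] at hiff
    refine ⟨F :: L, List.nodup_cons.2 ⟨fun hm => ((hiff F).1 hm).2 rfl, hnd⟩, fun A => ?_,
      ⟨fun hne => ?_, fun x y hx hy hxy hz => ?_⟩, hchain⟩
    · rw [List.mem_cons, hiff]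
      grind
    · by_cases hFe : (F.erase v).Nonempty
      · have hFr : F.erase v ∈ reduceAt S v :=
          h.mem_reduceAt.2 ⟨h.down F hF.1 _ (Finset.erase_subset _ _) hFe, by simp⟩
        obtain ⟨A, hA, hFA⟩ := exists_isMaxFace_superset hFr
        refine ⟨A, (hmem A).2 hA, fun x hx => hFA ?_⟩
        obtain ⟨hxL, hxF⟩ := Finset.mem_inter.1 hx
        exact Finset.mem_erase.2 ⟨by rintro rfl; exact hvL hxL, hxF⟩
      · obtain ⟨A, hA⟩ := List.exists_mem_of_ne_nil L hne
        refine ⟨A, hA, fun x hx => (hFe ⟨x, ?_⟩).elim⟩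
        obtain ⟨hxL, hxF⟩ := Finset.mem_inter.1 hx
        exact Finset.mem_erase.2 ⟨by rintro rfl; exact hvL hxL, hxF⟩
    · have hFV : ∀ x ∈ F, x ≠ v → x ∈ listUnion L := fun x hx hxv =>
        (hground x).2 (Finset.mem_erase.2 ⟨hxv, h.subset F hF.1 hx⟩)
      simp only [Finset.mem_union] at hx hy hz
      grind

theorem directedRIP_of_dirGrahamAcyclic (hG : DirGrahamAcyclic V S) (h : IsComplexOn V S) :
    DirectedRIP S := by
  induction hG with
  | base V S hV =>
    obtain ⟨a, rfl⟩ := Finset.card_eq_one.1 hV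
    have hS : ∀ A, A ∈ S ↔ A = {a} := by
      have hA : ∀ A ∈ S, A = {a} := fun A hA =>
        (Finset.Nonempty.subset_singleton_iff (h.nonempty A hA)).1 (h.subset A hA)
      obtain ⟨A, hAS, -⟩ := h.cover a (by simp)
      exact fun B => ⟨hA B, by rintro rfl; exact hA A hAS ▸ hAS⟩
    refine (directedRIP_iff S).2 ⟨[{a}], by simp, fun A => ?_, ⟨by simp, ?_⟩, trivial⟩
    · simp only [List.mem_singleton, IsMaxFace, hS]
      grind
    · intro x y hx hy hxy
      simp [listUnion] at hx hy
      omega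
  | step V S v hv hext hpred hsucc _ ih =>
    exact h.directedRIP_of_reduceAt hext hpred hsucc (ih (h.reduce v))

theorem exists_removable_of_directedRIP (h : IsComplexOn V S) (hV : V.Nonempty)
    (hS : DirectedRIP S) :
    ∃ v ∈ V, Extremal S v ∧
      (∀ u ∈ V, u < v → (∀ w ∈ V, w < v → w ≤ u) → ({u, v} : Finset ℕ) ∈ S) ∧
      (∀ w ∈ V, v < w → (∀ u ∈ V, v < u → w ≤ u) → ({v, w} : Finset ℕ) ∈ S) ∧
      DirectedRIP (reduceAt S v) := by
  obtain ⟨L, hnd, hmem, hchain⟩ := (directedRIP_iff _).1 hS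
  have hground : ∀ x, x ∈ listUnion L ↔ x ∈ V := fun x => h.mem_ground_iff hmem
  cases L with
  | nil =>
    obtain ⟨x, hx⟩ := hV
    simpa [listUnion] using (hground x).2 hx
  | cons T L =>
    obtain ⟨⟨hint, hcons⟩, hL⟩ := hchain
    obtain ⟨hTL, hnd⟩ := List.nodup_cons.1 hnd
    have hT : IsMaxFace S T := (hmem T).1 (by simp)
    have hLmax : ∀ A ∈ L, IsMaxFace S A := fun A hA => (hmem A).1 (by simp [hA])
    replace hground : ∀ x, x ∈ T ∪ listUnion L ↔ x ∈ V := hground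
    obtain ⟨v, hvT, hvL⟩ : ∃ v ∈ T, v ∉ listUnion L := by
      by_cases hne : L = []
      · obtain ⟨v, hv⟩ := h.nonempty T hT.1
        exact ⟨v, hv, by simp [hne, listUnion]⟩
      · obtain ⟨A, hA, hAs⟩ := hint hne
        by_contra! hc
        have : T = A := hT.2 A (hLmax A hA).1 fun x hx =>
          hAs (Finset.mem_inter.2 ⟨hc x hx, hx⟩)
        exact hTL (this ▸ hA)
    have hvV : v ∈ V := h.subset T hT.1 hvT
    have huniq : ∀ A, IsMaxFace S A → v ∈ A → A = T := by
      intro A hA hvA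
      rcases List.mem_cons.1 ((hmem A).2 hA) with rfl | hAL
      · rfl
      · exact (hvL (mem_listUnion.2 ⟨A, hAL, hvA⟩)).elim
    simp only [hground] at hcons
    have hp : ∀ u ∈ V, u < v → (∀ w ∈ V, w < v → w ≤ u) → u ∈ T := by
      intro u hu huv hmax
      have := hcons u v hu hvV huv fun z hz hlt => by have := hmax z hz hlt.2; omega
      tauto
    have hs : ∀ w ∈ V, v < w → (∀ u ∈ V, v < u → w ≤ u) → w ∈ T := by
      intro w hw hvw hmin
      have := hcons v w hvV hw hvw fun z hz hlt => by have := hmin z hz hlt.1; omega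
      tauto
    refine ⟨v, hvV, ⟨T, ⟨hT, hvT⟩, fun A hA => huniq A hA.1 hA.2⟩,
      fun u hu huv hmax => h.down T hT.1 _ ?_ (by simp),
      fun w hw hvw hmin => h.down T hT.1 _ ?_ (by simp), ?_⟩
    · simp [Finset.insert_subset_iff, hp u hu huv hmax, hvT]
    · simp [Finset.insert_subset_iff, hs w hw hvw hmin, hvT]
    rw [directedRIP_iff]
    have hiff : ∀ A, A ∈ L ↔ IsMaxFace S A ∧ A ≠ T := by
      intro A
      rw [← hmem, List.mem_cons]
      grind
    by_cases hTv : IsMaxFace (reduceAt S v) (T.erase v)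
    · refine ⟨T.erase v :: L, List.nodup_cons.2 ⟨fun hm => ?_, hnd⟩, fun A => ?_,
        ⟨fun hne => ?_, fun x y hx hy hxy hz => ?_⟩, hL⟩
      · have := (hLmax _ hm).2 T hT.1 (Finset.erase_subset _ _)
        exact Finset.erase_eq_self.1 this hvT
      · rw [h.isMaxFace_reduceAt_iff hT hvT huniq, List.mem_cons, hiff]
        tauto
      · obtain ⟨A, hA, hAs⟩ := hint hne
        exact ⟨A, hA, (Finset.inter_subset_inter_left (Finset.erase_subset _ _)).trans hAs⟩
      · have hU : ∀ x, x ∈ T.erase v ∪ listUnion L ↔ x ∈ V ∧ x ≠ v := by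
          intro x
          rw [← hground]
          simp only [Finset.mem_union, Finset.mem_erase]
          grind
        simp only [hU] at hx hy hz
        simp only [Finset.mem_erase]
        by_cases hxvy : x < v ∧ v < y
        · refine .inl ⟨⟨hx.2, hp x hx.1 hxvy.1 fun w hw hwv => ?_⟩,
            hy.2, hs y hy.1 hxvy.2 fun w hw hvw => ?_⟩
          · have := hz w ⟨hw, hwv.ne⟩
            omega
          · have := hz w ⟨hw, hvw.ne'⟩
            omega
        · have := hcons x y hx.1 hy.1 hxy fun z hzV hlt =>
            if hzv : z = v then hxvy (hzv ▸ hlt) else hz z ⟨hzV, hzv⟩ hlt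
          tauto
    · refine ⟨L, hnd, fun A => ?_, hL⟩
      rw [h.isMaxFace_reduceAt_iff hT hvT huniq, hiff]
      tauto

theorem dirGrahamAcyclic_of_directedRIP (h : IsComplexOn V S) (hV : V.Nonempty)
    (hS : DirectedRIP S) : DirGrahamAcyclic V S := by
  induction hn : V.card generalizing V S with
  | zero => simp_all
  | succ n ih =>
    obtain ⟨v, hv, hext, hpred, hsucc, hrec⟩ := h.exists_removable_of_directedRIP hV hS
    have hcard : (V.erase v).card = n := by rw [Finset.card_erase_of_mem hv, hn]; rfl
    rcases Nat.eq_zero_or_pos n with rfl | hpos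
    · exact .base V S hn
    · exact .step V S v hv hext hpred hsucc
        (ih (h.reduce v) (Finset.card_pos.1 (hcard ▸ hpos)) hrec hcard)

end IsComplexOn

/-- A directed simplicial complex on `{0, …, n}` is directed Graham acyclic
if and only if it has the directed running intersection property. -/
theorem dirGrahamAcyclic_iff_directedRIP (n : ℕ) (S : Finset (Finset ℕ))
    (hne : ∀ A ∈ S, A.Nonempty)
    (hsub : ∀ A ∈ S, A ⊆ Finset.range (n + 1))
    (hdc : ∀ A ∈ S, ∀ B : Finset ℕ, B ⊆ A → B.Nonempty → B ∈ S)
    (hcover : ∀ v ∈ Finset.range (n + 1), ∃ A ∈ S, v ∈ A) :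
    DirGrahamAcyclic (Finset.range (n + 1)) S ↔ DirectedRIP S := by
  have h : IsComplexOn (Finset.range (n + 1)) S := ⟨hne, hsub, hdc, hcover⟩
  exact ⟨fun hG => IsComplexOn.directedRIP_of_dirGrahamAcyclic hG h,
    h.dirGrahamAcyclic_of_directedRIP (by simp)⟩
end
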